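/- arXiv:1608.03554 — 4 statements merged into one kernel-verified Lean document; each statement's English description precedes it below -/
import Mathlib

section
/- Main Lemma (existence of Liouville measure from local couplings): Let G be a countable group generated by a finite set S, acting on a countable set X with a fixed base point o, and let d be the Schreier graph metric. Suppose there exist an increasing sequence of finite subsets (K_n) exhausting X and a sequence ε_n ↓ 0 such that for each n there is a finitely supported probability measure ν_n on G with ‖ν_n·x − ν_n·y‖₁ < ε_n for all x, y ∈ K_n with y = s·x for some s ∈ S. Then there exists a non-degenerate probability measure μ on G (a countable convex combination of a subsequence of the ν_n together with the uniform measure on S ∪ S^{-1}) such that every bounded P_μ-harmonic function on X is constant. -/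
open scoped Classical
open Filter

noncomputable section

variable {G : Type*} [Group G] {X : Type*} [MulAction G X]

/-- Pushforward of a discrete measure `μ` on `G` under the action at `x`. -/
def pushMeas (μ : G → ℝ) (x : X) : X → ℝ :=
  fun y => ∑' g : G, if g • x = y then μ g else 0

/-- ℓ¹ distance between two functions. -/
def dist1 {Y : Type*} (f g : Y → ℝ) : ℝ := ∑' y, |f y - g y|

/-- Convolution of discrete measures: `(μ ∗ ν)(g) = ∑_h μ(g h⁻¹) ν(h)`. -/
def conv (μ ν : G → ℝ) : G → ℝ := fun g => ∑' h : G, μ (g * h⁻¹) * ν h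

/-- Point mass at the identity. -/
def deltaOne : G → ℝ := fun g => if g = 1 then 1 else 0

/-- `n`-fold convolution power `μ^{(n)}` (innermost factor applied first). -/
def convPow (μ : G → ℝ) : ℕ → (G → ℝ)
  | 0 => deltaOne
  | n + 1 => conv (convPow μ n) μ

/-- `n`-step kernel (matrix power). -/
def kpow {Y : Type*} (P : Y → Y → ℝ) : ℕ → (Y → Y → ℝ)
  | 0 => fun x y => if x = y then 1 else 0
  | n + 1 => fun x y => ∑' z, P x z * kpow P n z y

/-- Transition kernel on `X` induced by `μ`. -/
def transK (μ : G → ℝ) (x y : X) : ℝ := pushMeas μ x y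

/-- A function is `P`-harmonic. -/
def IsHarmonic {Y : Type*} (P : Y → Y → ℝ) (h : Y → ℝ) : Prop :=
  ∀ x, h x = ∑' y, P x y * h y

/-- Boundedness of a real function. -/
def BoundedFn {Y : Type*} (h : Y → ℝ) : Prop := ∃ C, ∀ x, |h x| ≤ C

/-- `μ` is a (discrete) probability measure. -/
def IsProb {G : Type*} (μ : G → ℝ) : Prop := (∀ g, 0 ≤ μ g) ∧ HasSum μ 1

open scoped Pointwise

/-- The averaging operator of a discrete measure `m` acting on functions on `X`. -/
def avgOp {G : Type*} [Group G] {X : Type*} [MulAction G X] (m : G → ℝ) (h : X → ℝ) (x : X) : ℝ :=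
  ∑' g : G, m g * h (g • x)

/-- Dyadic mixture of a sequence of discrete measures. -/
def dyadicMix {G : Type*} (ρ : ℕ → G → ℝ) (g : G) : ℝ := ∑' i, (1 / 2 : ℝ) ^ (i + 1) * ρ i g

theorem IsProb.summable_mul {G : Type*} {m f : G → ℝ} (hm : IsProb m) {C : ℝ}
    (hf : ∀ g, |f g| ≤ C) : Summable fun g => m g * f g := by
  refine Summable.of_norm_bounded (hm.2.summable.mul_right C) fun g => ?_
  rw [Real.norm_eq_abs, abs_mul, abs_of_nonneg (hm.1 g)]
  exact mul_le_mul_of_nonneg_left (hf g) (hm.1 g)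

theorem IsProb.abs_tsum_mul_le {G : Type*} {m f : G → ℝ} (hm : IsProb m) {C : ℝ}
    (hf : ∀ g, m g ≠ 0 → |f g| ≤ C) : |∑' g, m g * f g| ≤ C := by
  have h1 : HasSum (fun g => m g * C) C := by simpa using hm.2.mul_right C
  refine tsum_of_norm_bounded (E := ℝ) h1 fun g => ?_
  rw [Real.norm_eq_abs, abs_mul, abs_of_nonneg (hm.1 g)]
  by_cases hg : m g = 0
  · simp [hg]
  · exact mul_le_mul_of_nonneg_left (hf g hg) (hm.1 g)

theorem hasSum_dyadic : HasSum (fun i : ℕ => (1 / 2 : ℝ) ^ (i + 1)) 1 := by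
  have := hasSum_geometric_two.mul_left (1 / 2 : ℝ)
  simpa [pow_succ, mul_comm] using this

theorem hasSum_pushMeas_mul {m : G → ℝ} (hm : IsProb m) {h : X → ℝ} {C : ℝ}
    (hh : ∀ x, |h x| ≤ C) (x : X) :
    HasSum (fun y => pushMeas m x y * h y) (avgOp m h x) := by
  have h1 := (hm.summable_mul (f := fun g => h (g • x)) fun g => hh _).hasSum.tsum_fiberwise
    (fun g : G => g • x)
  refine (congrArg (HasSum · _) (funext fun y => ?_)).mpr h1
  rw [tsum_subtype ((fun g : G => g • x) ⁻¹' {y}) (fun g => m g * h (g • x)), pushMeas,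
    ← tsum_mul_right]
  refine tsum_congr fun g => ?_
  by_cases hg : g • x = y <;> simp [Set.indicator, hg]

theorem abs_avgOp_sub_le_dist1 {m : G → ℝ} (hm : IsProb m) {h : X → ℝ} {C : ℝ}
    (hh : ∀ x, |h x| ≤ C) (x y : X) :
    |avgOp m h x - avgOp m h y| ≤ dist1 (pushMeas m x) (pushMeas m y) * C := by
  have hpush : ∀ z : X, Summable (pushMeas m z) := fun z => by
    simpa using (hasSum_pushMeas_mul hm (h := fun _ => 1) (C := 1) (by simp) z).summable
  have h1 := (hasSum_pushMeas_mul hm hh x).sub (hasSum_pushMeas_mul hm hh y)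
  have h2 := ((hpush x).sub (hpush y)).abs.hasSum.mul_right C
  rw [← h1.tsum_eq]
  refine tsum_of_norm_bounded (E := ℝ) h2 fun z => ?_
  rw [Real.norm_eq_abs, ← sub_mul, abs_mul]
  exact mul_le_mul_of_nonneg_left (hh z) (abs_nonneg _)

theorem abs_avgOp_sub_le {m : G → ℝ} (hm : IsProb m) {h : X → ℝ} {C : ℝ} (hh : ∀ x, |h x| ≤ C)
    {x y : X} {D : ℝ} (hD : ∀ g, m g ≠ 0 → |h (g • x) - h (g • y)| ≤ D) :
    |avgOp m h x - avgOp m h y| ≤ D := by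
  rw [avgOp, avgOp, ← (hm.summable_mul fun g => hh (g • x)).tsum_sub
    (hm.summable_mul fun g => hh (g • y))]
  simp only [← mul_sub]
  exact hm.abs_tsum_mul_le hD

theorem summable_dyadic_mul {G : Type*} {ρ : ℕ → G → ℝ} (hρ : ∀ i, IsProb (ρ i)) {f : G → ℝ} {C : ℝ}
    (hf : ∀ g, |f g| ≤ C) :
    Summable fun p : ℕ × G => (1 / 2 : ℝ) ^ (p.1 + 1) * ρ p.1 p.2 * f p.2 := by
  have hnn : ∀ p : ℕ × G, 0 ≤ (1 / 2 : ℝ) ^ (p.1 + 1) * ρ p.1 p.2 := fun p =>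
    mul_nonneg (by positivity) ((hρ _).1 _)
  have h1 : Summable fun p : ℕ × G => (1 / 2 : ℝ) ^ (p.1 + 1) * ρ p.1 p.2 := by
    refine (summable_prod_of_nonneg hnn).mpr
      ⟨fun i => (hρ i).2.summable.mul_left ((1 / 2 : ℝ) ^ (i + 1)), ?_⟩
    simp only [tsum_mul_left, (hρ _).2.tsum_eq, mul_one]
    exact hasSum_dyadic.summable
  refine Summable.of_norm_bounded (h1.mul_right C) fun p => ?_
  rw [Real.norm_eq_abs, abs_mul, abs_of_nonneg (hnn p)]
  exact mul_le_mul_of_nonneg_left (hf _) (hnn p)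

theorem hasSum_dyadicMix_mul {G : Type*} {ρ : ℕ → G → ℝ} (hρ : ∀ i, IsProb (ρ i)) {f : G → ℝ} {C : ℝ}
    (hf : ∀ g, |f g| ≤ C) :
    HasSum (fun g => dyadicMix ρ g * f g) (∑' i, (1 / 2 : ℝ) ^ (i + 1) * ∑' g, ρ i g * f g) := by
  have hs := summable_dyadic_mul hρ hf
  have h1 := hs.prod_symm.hasSum.prod_fiberwise fun g => (hs.prod_symm.prod_factor g).hasSum
  have h2 : ∑' p : G × ℕ, (fun p : ℕ × G => (1 / 2 : ℝ) ^ (p.1 + 1) * ρ p.1 p.2 * f p.2) p.swap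
      = ∑' i, (1 / 2 : ℝ) ^ (i + 1) * ∑' g, ρ i g * f g := by
    refine ((Equiv.prodComm G ℕ).tsum_eq
      (fun p : ℕ × G => (1 / 2 : ℝ) ^ (p.1 + 1) * ρ p.1 p.2 * f p.2)).trans ?_
    rw [hs.tsum_prod]
    simp only [mul_assoc, tsum_mul_left]
  rw [h2] at h1
  refine (congrArg (HasSum · _) (funext fun g => ?_)).mpr h1
  rw [dyadicMix, ← tsum_mul_right]
  rfl

theorem IsProb.dyadicMix {G : Type*} {ρ : ℕ → G → ℝ} (hρ : ∀ i, IsProb (ρ i)) : IsProb (dyadicMix ρ) := by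
  refine ⟨fun g => tsum_nonneg fun i => mul_nonneg (by positivity) ((hρ i).1 g), ?_⟩
  have := hasSum_dyadicMix_mul hρ (f := fun _ => 1) (C := 1) (by simp)
  simpa only [mul_one, (hρ _).2.tsum_eq, hasSum_dyadic.tsum_eq] using this

theorem support_subset_support_dyadicMix {G : Type*} {ρ : ℕ → G → ℝ} (hρ : ∀ i, IsProb (ρ i)) (i : ℕ) :
    Function.support (ρ i) ⊆ Function.support (dyadicMix ρ) := by
  intro g hg
  have hs : Summable fun k : ℕ => (1 / 2 : ℝ) ^ (k + 1) * ρ k g := by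
    simpa using (summable_dyadic_mul hρ (f := fun _ => 1) (C := 1) (by simp)).prod_symm.prod_factor g
  have hnn : ∀ k : ℕ, 0 ≤ (1 / 2 : ℝ) ^ (k + 1) * ρ k g := fun k =>
    mul_nonneg (by positivity) ((hρ k).1 g)
  exact (hs.tsum_pos hnn i (mul_pos (by positivity) (((hρ i).1 g).lt_of_ne' hg))).ne'

theorem IsHarmonic.eq_tsum_avgOp {ρ : ℕ → G → ℝ} (hρ : ∀ i, IsProb (ρ i)) {h : X → ℝ} {C : ℝ}
    (hh : ∀ x, |h x| ≤ C) (hharm : IsHarmonic (transK (dyadicMix ρ)) h) (x : X) :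
    h x = ∑' i, (1 / 2 : ℝ) ^ (i + 1) * avgOp (ρ i) h x := by
  rw [hharm x]
  simp only [transK]
  rw [(hasSum_pushMeas_mul (IsProb.dyadicMix hρ) hh x).tsum_eq, avgOp,
    (hasSum_dyadicMix_mul hρ fun g => hh (g • x)).tsum_eq]
  rfl

theorem hasSum_dyadic_ite (j : ℕ) (a b : ℝ) :
    HasSum (fun i : ℕ => (1 / 2 : ℝ) ^ (i + 1) * if i ≤ j then a else b)
      ((1 - (1 / 2) ^ (j + 1)) * a + (1 / 2) ^ (j + 1) * b) := by
  rw [← hasSum_nat_add_iff' (j + 1)]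
  have h1 : ∑ i ∈ Finset.range (j + 1), ((1 / 2 : ℝ) ^ (i + 1) * if i ≤ j then a else b)
      = (1 - (1 / 2) ^ (j + 1)) * a := by
    have : ∀ i ∈ Finset.range (j + 1), ((1 / 2 : ℝ) ^ (i + 1) * if i ≤ j then a else b)
        = (1 / 2) ^ i * ((1 / 2) * a) := fun i hi => by
      rw [if_pos (by simpa [Nat.lt_succ_iff] using hi), pow_succ, mul_assoc]
    rw [Finset.sum_congr rfl this, ← Finset.sum_mul, geom_sum_eq (by norm_num)]
    ring
  rw [h1, add_sub_cancel_left]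
  have h2 := (hasSum_dyadic.mul_left ((1 / 2 : ℝ) ^ (j + 1))).mul_right b
  rw [mul_one] at h2
  refine (congrArg (HasSum · _) (funext fun i => ?_)).mpr h2
  rw [if_neg (by omega)]
  ring

theorem IsHarmonic.abs_sub_le_step {ρ : ℕ → G → ℝ} (hρ : ∀ i, IsProb (ρ i)) {h : X → ℝ} {C : ℝ}
    (hh : ∀ x, |h x| ≤ C) (hharm : IsHarmonic (transK (dyadicMix ρ)) h) {x y : X} {j : ℕ}
    {D E : ℝ} (hD : ∀ i ≤ j, ∀ g, ρ i g ≠ 0 → |h (g • x) - h (g • y)| ≤ D)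
    (hE : ∀ i, j < i → |avgOp (ρ i) h x - avgOp (ρ i) h y| ≤ E) :
    |h x - h y| ≤ (1 - (1 / 2) ^ (j + 1)) * D + (1 / 2) ^ (j + 1) * E := by
  have hsum : ∀ z : X, Summable fun i : ℕ => (1 / 2 : ℝ) ^ (i + 1) * avgOp (ρ i) h z := fun z =>
    IsProb.summable_mul ⟨fun i => by positivity, hasSum_dyadic⟩ (C := C) fun i =>
      (hρ i).abs_tsum_mul_le fun g _ => hh _
  rw [hharm.eq_tsum_avgOp hρ hh x, hharm.eq_tsum_avgOp hρ hh y, ← (hsum x).tsum_sub (hsum y)]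
  refine tsum_of_norm_bounded (E := ℝ) (hasSum_dyadic_ite j D E) fun i => ?_
  rw [← mul_sub, Real.norm_eq_abs, abs_mul, abs_of_pos (by positivity : (0 : ℝ) < (1 / 2) ^ (i + 1))]
  refine mul_le_mul_of_nonneg_left ?_ (by positivity)
  split_ifs with hi
  · exact abs_avgOp_sub_le (hρ i) hh (hD i hi)
  · exact hE i (not_le.mp hi)

/-- `m` sends any two points of `F` to distributions that bounded functions
distinguish by at most `δ`. -/
def ContractsOn (m : G → ℝ) (F : Finset X) (δ : ℝ) : Prop :=
  ∀ p ∈ F, ∀ q ∈ F, ∀ (h : X → ℝ) (C : ℝ), (∀ x, |h x| ≤ C) →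
    |avgOp m h p - avgOp m h q| ≤ δ * C

theorem IsHarmonic.abs_sub_le_of_contractsOn {ρ : ℕ → G → ℝ} (hρ : ∀ i, IsProb (ρ i))
    {h : X → ℝ} {C : ℝ} (hh : ∀ x, |h x| ≤ C) (hharm : IsHarmonic (transK (dyadicMix ρ)) h)
    {j L : ℕ} {δ : ℝ} {T : Finset G} {F : Finset X} (h1 : 1 ∈ T)
    (hT : ∀ i ≤ j, ∀ g, ρ i g ≠ 0 → g ∈ T)
    (hc : ∀ i, j < i → ContractsOn (ρ i) (T ^ L • F) δ) {x y : X} (hx : x ∈ F) (hy : y ∈ F) :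
    |h x - h y| ≤ δ * C + (1 - (1 / 2) ^ (j + 1)) ^ L * (2 * C) := by
  have key : ∀ k l, k + l = L → ∀ x ∈ T ^ l • F, ∀ y ∈ T ^ l • F,
      |h x - h y| ≤ δ * C + (1 - (1 / 2) ^ (j + 1)) ^ k * (2 * C) := by
    intro k
    induction k with
    | zero =>
      intro l hl x hx y hy
      obtain rfl : l = L := by omega
      have hE := hc (j + 1) (Nat.lt_succ_self j) x hx y hy h C hh
      have hδC : 0 ≤ δ * C := (abs_nonneg _).trans hE
      have h2 : |h x - h y| ≤ |h x| + |h y| := abs_sub _ _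
      rw [pow_zero]
      linarith [hh x, hh y]
    | succ k ih =>
      intro l hl x hx y hy
      have hsub : T ^ l • F ⊆ T ^ L • F :=
        Finset.smul_subset_smul_right (Finset.pow_subset_pow_right h1 (by omega))
      have hstep := hharm.abs_sub_le_step hρ hh (x := x) (y := y) (j := j)
        (fun i hi g hg => ih (l + 1) (by omega) (g • x)
          (by rw [pow_succ', mul_smul]; exact Finset.smul_mem_smul (hT i hi g hg) hx) (g • y)
          (by rw [pow_succ', mul_smul]; exact Finset.smul_mem_smul (hT i hi g hg) hy))
        (fun i hi => hc i hi x (hsub hx) y (hsub hy) h C hh)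
      refine hstep.trans_eq ?_
      ring
  exact key L 0 (by simp) x (by simpa using hx) y (by simpa using hy)

theorem eventually_contracts_pair (S : Finset G) (hgen : Subgroup.closure (S : Set G) = ⊤)
    (K : ℕ → Finset X) (hKmono : Monotone K) (hKex : ∀ x : X, ∃ n, x ∈ K n)
    (ε : ℕ → ℝ) (hεlim : Tendsto ε atTop (nhds 0))
    (ν : ℕ → G → ℝ) (hν : ∀ n, IsProb (ν n))
    (hcouple : ∀ n, ∀ x ∈ K n, ∀ s ∈ S, s • x ∈ K n →
      dist1 (pushMeas (ν n) x) (pushMeas (ν n) (s • x)) < ε n) (g : G) :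
    ∀ x : X, ∀ δ : ℝ, 0 < δ → ∀ᶠ n in atTop, ∀ (h : X → ℝ) (C : ℝ), (∀ x, |h x| ≤ C) →
      |avgOp (ν n) h x - avgOp (ν n) h (g • x)| ≤ δ * C := by
  have hg : g ∈ Subgroup.closure (S : Set G) := hgen ▸ Subgroup.mem_top g
  have hmem : ∀ x : X, ∀ᶠ n in atTop, x ∈ K n := fun x => by
    obtain ⟨n, hn⟩ := hKex x
    exact eventually_atTop.mpr ⟨n, fun m hm => hKmono hm hn⟩
  induction hg using Subgroup.closure_induction with
  | mem s hs =>
    intro x δ hδ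
    filter_upwards [hmem x, hmem (s • x), hεlim.eventually_lt_const hδ] with n h1 h2 h3 h C hh
    refine (abs_avgOp_sub_le_dist1 (hν n) hh x (s • x)).trans ?_
    have hC : 0 ≤ C := (abs_nonneg _).trans (hh x)
    exact mul_le_mul_of_nonneg_right ((hcouple n x h1 s hs h2).le.trans h3.le) hC
  | one =>
    intro x δ hδ
    refine Eventually.of_forall fun n h C hh => ?_
    have hC : 0 ≤ C := (abs_nonneg _).trans (hh x)
    simpa using mul_nonneg hδ.le hC
  | mul a b _ _ ha hb =>
    intro x δ hδ
    filter_upwards [hb x (δ / 2) (half_pos hδ), ha (b • x) (δ / 2) (half_pos hδ)]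
      with n h1 h2 h C hh
    rw [mul_smul]
    refine (abs_sub_le _ (avgOp (ν n) h (b • x)) _).trans ?_
    linarith [h1 h C hh, h2 h C hh]
  | inv a _ ha =>
    intro x δ hδ
    filter_upwards [ha (a⁻¹ • x) δ hδ] with n h1 h C hh
    rw [abs_sub_comm]
    simpa using h1 h C hh

theorem isProb_uniform {G : Type*} {T : Finset G} (hT : T.Nonempty) :
    IsProb fun g => if g ∈ T then (T.card : ℝ)⁻¹ else 0 := by
  refine ⟨fun g => by dsimp only; split_ifs <;> positivity, ?_⟩
  have h1 : HasSum (fun g => if g ∈ T then (T.card : ℝ)⁻¹ else 0)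
      (∑ g ∈ T, if g ∈ T then (T.card : ℝ)⁻¹ else 0) :=
    hasSum_sum_of_ne_finset_zero fun g hg => if_neg hg
  have h2 : (T.card : ℝ) ≠ 0 := by exact_mod_cast hT.card_pos.ne'
  simpa [Finset.sum_ite_mem, h2] using h1

theorem tendsto_one_sub_half_pow_pow :
    Tendsto (fun j : ℕ => (1 - (1 / 2 : ℝ) ^ (j + 1)) ^ (4 ^ (j + 1))) atTop (nhds 0) := by
  have h1 : Tendsto (fun j : ℕ => Real.exp (-(2 : ℝ) ^ (j + 1))) atTop (nhds 0) :=
    Real.tendsto_exp_neg_atTop_nhds_zero.comp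
      ((tendsto_pow_atTop_atTop_of_one_lt one_lt_two).comp (tendsto_add_atTop_nat 1))
  have hle : ∀ j : ℕ, 0 ≤ 1 - (1 / 2 : ℝ) ^ (j + 1) := fun j =>
    sub_nonneg.mpr (pow_le_one₀ (by norm_num) (by norm_num))
  refine squeeze_zero (fun j => pow_nonneg (hle j) _) (fun j => ?_) h1
  refine (pow_le_pow_left₀ (hle j) (Real.one_sub_le_exp_neg _) _).trans_eq ?_
  rw [← Real.exp_nat_mul]
  congr 1
  push_cast
  rw [mul_neg, ← mul_pow]
  norm_num

/-- Main Lemma: from finitely supported measures with good coupling on an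
exhaustion of X, one builds a non-degenerate Liouville measure. -/
theorem stmt6 {G : Type*} [Group G] [Countable G] {X : Type*} [MulAction G X] [Countable X]
    (S : Finset G) (hgen : Subgroup.closure (S : Set G) = ⊤)
    (htrans : ∀ x y : X, ∃ g : G, g • x = y)
    (K : ℕ → Finset X) (hKmono : Monotone K) (hKex : ∀ x : X, ∃ n, x ∈ K n)
    (ε : ℕ → ℝ) (hεanti : Antitone ε) (hεpos : ∀ n, 0 < ε n)
    (hεlim : Filter.Tendsto ε Filter.atTop (nhds 0))
    (ν : ℕ → G → ℝ) (hν : ∀ n, IsProb (ν n)) (hνfin : ∀ n, (Function.support (ν n)).Finite)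
    (hcouple : ∀ n, ∀ x ∈ K n, ∀ s ∈ S, s • x ∈ K n →
      dist1 (pushMeas (ν n) x) (pushMeas (ν n) (s • x)) < ε n) :
    ∃ μ : G → ℝ, IsProb μ ∧ Subgroup.closure (Function.support μ) = ⊤ ∧
      ∀ h : X → ℝ, BoundedFn h → IsHarmonic (transK μ) h → ∀ x y : X, h x = h y := by
  have hpick : ∀ (F : Finset X) (δ : ℝ), 0 < δ → ∃ n, ContractsOn (ν n) F δ := by
    intro F δ hδ
    have hpair := eventually_contracts_pair S hgen K hKmono hKex ε hεlim ν hν hcouple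
    have hev : ∀ᶠ n in atTop, ContractsOn (ν n) F δ := by
      refine (Filter.eventually_all_finset F).mpr fun p _ =>
        (Filter.eventually_all_finset F).mpr fun q _ => ?_
      obtain ⟨g, rfl⟩ := htrans p q
      exact hpair g p δ hδ
    exact hev.exists
  have hδpos : ∀ i : ℕ, (0 : ℝ) < 1 / ((i : ℝ) + 1) := fun i => by positivity
  choose N hN using fun (i : ℕ) (T : Finset G) =>
    hpick (T ^ (4 ^ (i + 1)) • K i) (1 / ((i : ℝ) + 1)) (hδpos i)
  let T : ℕ → Finset G := fun i =>
    Nat.rec (insert 1 S) (fun i T => T ∪ (hνfin (N i T)).toFinset) i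
  let ρ : ℕ → G → ℝ := fun i =>
    Nat.casesOn i (fun g => if g ∈ insert 1 S then ((insert 1 S : Finset G).card : ℝ)⁻¹ else 0)
      fun i => ν (N i (T i))
  have hTmono : Monotone T := monotone_nat_of_le_succ fun i => Finset.subset_union_left
  have hT1 : ∀ i, 1 ∈ T i := fun i => hTmono (Nat.zero_le i) (Finset.mem_insert_self 1 S)
  have hρ : ∀ i, IsProb (ρ i) := by
    rintro (_ | i)
    · exact isProb_uniform (Finset.insert_nonempty 1 S)
    · exact hν _
  have hρT : ∀ i g, ρ i g ≠ 0 → g ∈ T i := by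
    rintro (_ | i) g hg
    · by_contra hgT
      exact hg (if_neg hgT)
    · exact Finset.mem_union_right _ ((hνfin _).mem_toFinset.mpr hg)
  refine ⟨dyadicMix ρ, IsProb.dyadicMix hρ, ?_, ?_⟩
  · rw [eq_top_iff, ← hgen]
    refine Subgroup.closure_mono fun s hs => support_subset_support_dyadicMix hρ 0 ?_
    have hs' : s ∈ insert 1 S := Finset.mem_insert_of_mem hs
    have hcard : ((insert 1 S : Finset G).card : ℝ) ≠ 0 := by
      exact_mod_cast (Finset.insert_nonempty 1 S).card_pos.ne'
    change (if s ∈ insert 1 S then ((insert 1 S : Finset G).card : ℝ)⁻¹ else 0) ≠ 0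
    rw [if_pos hs']
    exact inv_ne_zero hcard
  · rintro h ⟨C, hC⟩ hharm x y
    have hcontr : ∀ j i, j < i →
        ContractsOn (ρ i) (T j ^ (4 ^ (j + 1)) • K j) (1 / ((j : ℝ) + 1)) := by
      rintro j (_ | i) hji p hp q hq f D hf
      · omega
      have hji' : j ≤ i := Nat.lt_succ_iff.mp hji
      have hsub : T j ^ (4 ^ (j + 1)) • K j ⊆ T i ^ (4 ^ (i + 1)) • K i :=
        Finset.smul_subset_smul (Finset.pow_subset_pow (hTmono hji') (hT1 i)
          (Nat.pow_le_pow_right (by norm_num) (by omega))) (hKmono hji')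
      refine (hN i (T i) p (hsub hp) q (hsub hq) f D hf).trans ?_
      exact mul_le_mul_of_nonneg_right (Nat.one_div_le_one_div hji')
        ((abs_nonneg _).trans (hf p))
    obtain ⟨a, ha⟩ := hKex x
    obtain ⟨b, hb⟩ := hKex y
    have hlim : Tendsto (fun j : ℕ => 1 / ((j : ℝ) + 1) * C
        + (1 - (1 / 2 : ℝ) ^ (j + 1)) ^ (4 ^ (j + 1)) * (2 * C)) atTop (nhds 0) := by
      simpa using (tendsto_one_div_add_atTop_nhds_zero_nat.mul_const C).add
        (tendsto_one_sub_half_pow_pow.mul_const (2 * C))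
    have hle : |h x - h y| ≤ 0 := by
      refine ge_of_tendsto hlim ?_
      filter_upwards [eventually_ge_atTop a, eventually_ge_atTop b] with j hja hjb
      exact hharm.abs_sub_le_of_contractsOn hρ hC (hT1 j)
        (fun i hi g hg => hTmono hi (hρT i g hg)) (hcontr j) (hKmono hja ha) (hKmono hjb hb)
    exact sub_eq_zero.mp (abs_nonpos_iff.mp hle)
end
end

section
/- Lemma (semidirect products): Let G ⋉ A be a semidirect product with G a countable discrete group and A a countable amenable group, acting on A by (g,a)·b = g·(ab) (where G acts on A by automorphisms and A by left translations). Then there exists a non-degenerate probability measure μ on G ⋉ A such that every bounded P_μ-harmonic function on A is constant, i.e., the action of G ⋉ A on A is μ-Liouville. -/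
open scoped Classical
open Filter

noncomputable section

variable {G : Type*} [Group G] {X : Type*} [MulAction G X]

/-- Transition kernel on `A` for the affine action of the semidirect product `A ⋊[φ] G`,
where `(a, g) • b = a * φ g b`. -/
def sdK {A G : Type*} [Group A] [Group G] (φ : G →* MulAut A)
    (μ : A ⋊[φ] G → ℝ) (x y : A) : ℝ :=
  ∑' w : A ⋊[φ] G, if w.left * φ w.right x = y then μ w else 0

/-- Pushforward of a weight `p` under a map `s`. -/
def pushWeight {ι W : Type*} (p : ι → ℝ) (s : ι → W) (w : W) : ℝ :=
  ∑' i, if s i = w then p i else 0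

theorem summable_fiber {ι W : Type*} {p : ι → ℝ} (hp : ∀ i, 0 ≤ p i) (hs : Summable p)
    (s : ι → W) (w : W) : Summable (fun i => if s i = w then p i else 0) := by
  refine Summable.of_nonneg_of_le (fun i => ?_) (fun i => ?_) hs
  · split_ifs
    exacts [hp i, le_rfl]
  · split_ifs
    exacts [le_rfl, hp i]

theorem pushWeight_nonneg {ι W : Type*} {p : ι → ℝ} (hp : ∀ i, 0 ≤ p i) (s : ι → W) (w : W) :
    0 ≤ pushWeight p s w :=
  tsum_nonneg fun i => by
    split_ifs
    exacts [hp i, le_rfl]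

theorem le_pushWeight {ι W : Type*} {p : ι → ℝ} (hp : ∀ i, 0 ≤ p i) (hs : Summable p)
    (s : ι → W) (i : ι) : p i ≤ pushWeight p s (s i) := by
  have := (summable_fiber hp hs s (s i)).le_tsum i fun k _ => by
    split_ifs
    exacts [hp k, le_rfl]
  rwa [if_pos rfl] at this

theorem summable_mul_of_bounded {ι : Type*} {p f : ι → ℝ} {C : ℝ} (hp : ∀ i, 0 ≤ p i)
    (hs : Summable p) (hf : ∀ i, |f i| ≤ C) : Summable (fun i => p i * f i) := by
  refine Summable.of_norm_bounded (hs.mul_right C) fun i => ?_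
  rw [Real.norm_eq_abs, abs_mul, abs_of_nonneg (hp i)]
  exact mul_le_mul_of_nonneg_left (hf _) (hp i)

/-- Change of variables for the pushforward of a summable weight, against a bounded function. -/
theorem hasSum_pushWeight_mul {ι W : Type*} {p : ι → ℝ} (hp : ∀ i, 0 ≤ p i) (hs : Summable p)
    (s : ι → W) {f : W → ℝ} {C : ℝ} (hf : ∀ w, |f w| ≤ C) :
    HasSum (fun w => pushWeight p s w * f w) (∑' i, p i * f (s i)) := by
  have hsum : Summable (fun i => p i * f (s i)) := summable_mul_of_bounded hp hs fun i => hf _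
  have hinj : Function.Injective (fun i : ι => (s i, i)) := fun i j hij => (Prod.mk.inj hij).2
  have hprod : HasSum (fun z : W × ι => if s z.2 = z.1 then p z.2 * f z.1 else 0)
      (∑' i, p i * f (s i)) := by
    rw [← hinj.hasSum_iff]
    · simpa [Function.comp_def] using hsum.hasSum
    · rintro ⟨w, i⟩ hw
      refine if_neg fun h => hw ⟨i, ?_⟩
      simpa using h
  refine hprod.prod_fiberwise fun w => ?_
  simpa [ite_mul, pushWeight] using (summable_fiber hp hs s w).hasSum.mul_right (f w)

/-- Inductive choice of Følner sets `F j`, each almost invariant under the points `K j` which are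
reachable from the first points `a 0, …, a j` in at most `N j` steps using the maps `σ l` and the
translations by inverses of elements of `F l`, for `l < j`. -/
theorem exists_folner_sequence {A : Type*} [Group A] [DecidableEq A]
    (hFol : ∀ (K : Finset A) (ε : ℝ), 0 < ε →
      ∃ F : Finset A, F.Nonempty ∧
        ∀ k ∈ K, ((symmDiff (F.image (fun a => k * a)) F).card : ℝ) ≤ ε * F.card)
    (a : ℕ → A) (N : ℕ → ℕ) (σ : ℕ → A → A) {η : ℕ → ℝ} (hη : ∀ j, 0 < η j) :
    ∃ F K : ℕ → Finset A, Monotone K ∧ ∀ j, (F j).Nonempty ∧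
      (∀ k ∈ K j, ((symmDiff ((F j).image (fun a => k⁻¹ * a)) (F j)).card : ℝ)
        ≤ η j * (F j).card) ∧
      ∃ T : ℕ → Finset A, (∀ l ≤ j, a l ∈ T 0) ∧ Monotone T ∧ T (N j) ⊆ K j ∧
        ∀ l < j, ∀ m, ∀ x ∈ T m, σ l x ∈ T (m + 1) ∧ ∀ f ∈ F l, f⁻¹ * x ∈ T (m + 1) := by
  choose Φ hΦne hΦ using fun (K : Finset A) (j : ℕ) => hFol (K.image (fun k => k⁻¹)) (η j) (hη j)
  let X : ℕ → Finset A := fun j => (Finset.range (j + 1)).image a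
  let reach : ℕ → (Finset A → Finset A) × Finset A → Finset A :=
    fun j s => s.2 ∪ (s.1^[N j]) (X j)
  let next : ℕ → (Finset A → Finset A) × Finset A → (Finset A → Finset A) × Finset A :=
    fun j s => (fun T => s.1 T ∪ (T.image (σ j) ∪
      Finset.image₂ (fun f x => f⁻¹ * x) (Φ (reach j s) j) T), reach j s)
  let S : ℕ → (Finset A → Finset A) × Finset A := fun j => Nat.rec (id, ∅) next j
  have hmono : ∀ T, Monotone (fun j => (S j).1 T) := fun T =>
    monotone_nat_of_le_succ fun j => Finset.subset_union_left
  have hself : ∀ j T, T ⊆ (S j).1 T := fun j T => hmono T (Nat.zero_le j)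
  refine ⟨fun j => Φ (reach j (S j)) j, fun j => reach j (S j), ?_, fun j => ⟨hΦne _ _, ?_, ?_⟩⟩
  · refine monotone_nat_of_le_succ fun j => ?_
    exact Finset.subset_union_left (s₁ := (S (j + 1)).2)
  · intro k hk
    exact hΦ _ j _ (Finset.mem_image_of_mem _ hk)
  · refine ⟨fun m => ((S j).1^[m]) (X j), ?_, ?_, Finset.subset_union_right, ?_⟩
    · intro l hl
      exact Finset.mem_image_of_mem _ (Finset.mem_range.2 (Nat.lt_succ_of_le hl))
    · refine monotone_nat_of_le_succ fun m => ?_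
      rw [Function.iterate_succ_apply']
      exact hself _ _
    · intro l hl m x hx
      have hsub := hmono (((S j).1^[m]) (X j)) (Nat.succ_le_of_lt hl)
      simp only [Function.iterate_succ_apply']
      refine ⟨hsub ?_, fun f hf => hsub ?_⟩
      · exact Finset.mem_union_right _ (Finset.mem_union_left _ (Finset.mem_image_of_mem _ hx))
      · exact Finset.mem_union_right _ (Finset.mem_union_right _ (Finset.mem_image₂_of_mem hf hx))

/-- The sums of a bounded function over two finite sets differ by at most the bound times the size
of the symmetric difference. -/
theorem abs_sum_sub_sum_le_card_symmDiff {A : Type*} [DecidableEq A] {u : A → ℝ} {C : ℝ}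
    (hu : ∀ x, |u x| ≤ C) (E F : Finset A) :
    |∑ x ∈ E, u x - ∑ x ∈ F, u x| ≤ (symmDiff E F).card * C := by
  have key : ∑ x ∈ E, u x - ∑ x ∈ F, u x = ∑ x ∈ E \ F, u x - ∑ x ∈ F \ E, u x := by
    rw [← Finset.sum_inter_add_sum_sdiff E F, ← Finset.sum_inter_add_sum_sdiff F E,
      Finset.inter_comm F E]
    ring
  have hb : ∀ s : Finset A, |∑ x ∈ s, u x| ≤ s.card * C := fun s => by
    refine (Finset.abs_sum_le_sum_abs _ _).trans ?_
    simpa using Finset.sum_le_sum fun x (_ : x ∈ s) => hu x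
  have hcard : (symmDiff E F).card = (E \ F).card + (F \ E).card :=
    Finset.card_union_of_disjoint disjoint_sdiff_sdiff
  rw [key, hcard, Nat.cast_add, add_mul]
  exact (abs_sub _ _).trans (add_le_add (hb _) (hb _))

/-- The sum of a bounded function over `F⁻¹ * x` is close to its sum over `F⁻¹` when `F`
is almost invariant under left translation by `x⁻¹`. -/
theorem abs_sum_inv_mul_sub_le {A : Type*} [Group A] [DecidableEq A] {h : A → ℝ} {C : ℝ}
    (hC : ∀ x, |h x| ≤ C) (F : Finset A) (x : A) :
    |∑ f ∈ F, h (f⁻¹ * x) - ∑ f ∈ F, h f⁻¹| ≤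
      (symmDiff (F.image (fun a => x⁻¹ * a)) F).card * C := by
  have := abs_sum_sub_sum_le_card_symmDiff (u := fun a => h a⁻¹) (fun a => hC _)
    (F.image (fun a => x⁻¹ * a)) F
  rwa [Finset.sum_image (fun _ _ _ _ hab => mul_left_cancel hab),
    Finset.sum_congr rfl (fun f _ => by rw [mul_inv_rev, inv_inv])] at this

/-- One-step average of `h` at `x`, under the mixture of the map `σ`, with weight `η`, and of
translation by the inverse of a uniform element of `F`. -/
def mixedAverage {A : Type*} [Group A] (h : A → ℝ) (η : ℝ) (σ : A → A) (F : Finset A) (x : A) :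
    ℝ :=
  η * h (σ x) + (1 - η) / F.card * ∑ f ∈ F, h (f⁻¹ * x)

theorem abs_mixedAverage_sub_le {A : Type*} [Group A] {h : A → ℝ} {η B : ℝ} {σ : A → A}
    {F : Finset A} (hF : F.Nonempty) (hη0 : 0 ≤ η) (hη1 : η ≤ 1) {x y : A}
    (hσ : |h (σ x) - h (σ y)| ≤ B) (hB : ∀ f ∈ F, |h (f⁻¹ * x) - h (f⁻¹ * y)| ≤ B) :
    |mixedAverage h η σ F x - mixedAverage h η σ F y| ≤ B := by
  have hc : (0 : ℝ) < F.card := by exact_mod_cast hF.card_pos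
  have hsum : |∑ f ∈ F, (h (f⁻¹ * x) - h (f⁻¹ * y))| ≤ F.card * B := by
    refine (Finset.abs_sum_le_sum_abs _ _).trans ?_
    simpa using Finset.sum_le_sum hB
  have heq : mixedAverage h η σ F x - mixedAverage h η σ F y = η * (h (σ x) - h (σ y)) +
      (1 - η) / F.card * ∑ f ∈ F, (h (f⁻¹ * x) - h (f⁻¹ * y)) := by
    rw [mixedAverage, mixedAverage, Finset.sum_sub_distrib]
    ring
  have hw : 0 ≤ (1 - η) / F.card := div_nonneg (sub_nonneg.2 hη1) hc.le
  calc _ ≤ η * B + (1 - η) / F.card * (F.card * B) := by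
        rw [heq]
        refine (abs_add_le _ _).trans ?_
        rw [abs_mul, abs_mul, abs_of_nonneg hη0, abs_of_nonneg hw]
        gcongr
    _ = B := by field_simp; ring

theorem abs_mixedAverage_sub_le_of_folner {A : Type*} [Group A] [DecidableEq A] {h : A → ℝ}
    {C η : ℝ} {σ : A → A} {F : Finset A} (hC : ∀ x, |h x| ≤ C) (hF : F.Nonempty) (hη0 : 0 ≤ η)
    (hη1 : η ≤ 1) {x y : A}
    (hx : ((symmDiff (F.image (fun a => x⁻¹ * a)) F).card : ℝ) ≤ η * F.card)
    (hy : ((symmDiff (F.image (fun a => y⁻¹ * a)) F).card : ℝ) ≤ η * F.card) :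
    |mixedAverage h η σ F x - mixedAverage h η σ F y| ≤ 4 * C * η := by
  have hC0 : 0 ≤ C := (abs_nonneg _).trans (hC 1)
  have hc : (0 : ℝ) < F.card := by exact_mod_cast hF.card_pos
  have hsx := (abs_sum_inv_mul_sub_le hC F x).trans (mul_le_mul_of_nonneg_right hx hC0)
  have hsy := (abs_sum_inv_mul_sub_le hC F y).trans (mul_le_mul_of_nonneg_right hy hC0)
  have hsum : |∑ f ∈ F, h (f⁻¹ * x) - ∑ f ∈ F, h (f⁻¹ * y)| ≤ 2 * (η * F.card * C) := by
    rw [abs_le] at hsx hsy ⊢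
    constructor <;> linarith [hsx.1, hsx.2, hsy.1, hsy.2]
  have hσ : |h (σ x) - h (σ y)| ≤ 2 * C :=
    (abs_sub _ _).trans (by linarith [hC (σ x), hC (σ y)])
  have hw : 0 ≤ (1 - η) / F.card := div_nonneg (sub_nonneg.2 hη1) hc.le
  have heq : mixedAverage h η σ F x - mixedAverage h η σ F y = η * (h (σ x) - h (σ y)) +
      (1 - η) / F.card * (∑ f ∈ F, h (f⁻¹ * x) - ∑ f ∈ F, h (f⁻¹ * y)) := by
    rw [mixedAverage, mixedAverage]
    ring
  calc _ ≤ η * (2 * C) + (1 - η) / F.card * (2 * (η * F.card * C)) := by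
        rw [heq]
        refine (abs_add_le _ _).trans ?_
        rw [abs_mul, abs_mul, abs_of_nonneg hη0, abs_of_nonneg hw]
        gcongr
    _ = 4 * C * η - 2 * C * η ^ 2 := by field_simp; ring
    _ ≤ 4 * C * η := by nlinarith [mul_nonneg hC0 (sq_nonneg η)]

/-- If `h` is an average of functions `P j` whose increments on the `T m` are small for `j ≥ i`, and are
controlled by the increments of `h` one step further for `j < i`, then the increments of `h` are
small. -/
theorem abs_sub_le_of_chain {A : Type*} {h : A → ℝ} {P : ℕ → A → ℝ} {c : ℕ → ℝ}
    (hc0 : ∀ j, 0 ≤ c j) (hc1 : HasSum c 1) {C δ : ℝ} (hC : ∀ x, |h x| ≤ C)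
    (hP : ∀ x, HasSum (fun j => c j * P j x) (h x)) {i n : ℕ} {T : ℕ → Finset A}
    (htail : ∀ m ≤ n, ∀ x ∈ T m, ∀ y ∈ T m, ∀ j ≥ i, |P j x - P j y| ≤ δ)
    (hstep : ∀ m, ∀ x ∈ T m, ∀ y ∈ T m, ∀ B,
      (∀ x ∈ T (m + 1), ∀ y ∈ T (m + 1), |h x - h y| ≤ B) → ∀ j < i, |P j x - P j y| ≤ B)
    (k m : ℕ) (hkm : m + k = n) :
    ∀ x ∈ T m, ∀ y ∈ T m, |h x - h y| ≤ (∑ j ∈ Finset.range i, c j) ^ k * (2 * C) + δ := by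
  induction k generalizing m with
  | zero =>
    intro x hx y hy
    have hδ : 0 ≤ δ := (abs_nonneg _).trans (htail m (by omega) x hx y hy i le_rfl)
    have := abs_sub (h x) (h y)
    simp only [pow_zero, one_mul]
    linarith [hC x, hC y]
  | succ k ih =>
    intro x hx y hy
    set q := ∑ j ∈ Finset.range i, c j with hq
    have hB := hstep m x hx y hy _ (ih (m + 1) (by omega))
    have hδ := htail m (by omega) x hx y hy
    set B := q ^ k * (2 * C) + δ with hBdef
    have hdiff : HasSum (fun j => c j * (P j x - P j y)) (h x - h y) := by
      simpa only [mul_sub] using (hP x).sub (hP y)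
    have hbound : HasSum (fun j => c j * δ + if j ∈ Finset.range i then c j * (B - δ) else 0)
        (1 * δ + ∑ j ∈ Finset.range i, c j * (B - δ)) := by
      refine (hc1.mul_right δ).add ?_
      have := hasSum_sum_of_ne_finset_zero (s := Finset.range i)
        (f := fun j => if j ∈ Finset.range i then c j * (B - δ) else 0) (L := .unconditional ℕ)
        (fun j hj => if_neg hj)
      rwa [Finset.sum_congr rfl (fun j hj => if_pos hj)] at this
    have hle := tsum_of_norm_bounded (f := fun j => c j * (P j x - P j y)) hbound fun j => by
      rw [Real.norm_eq_abs, abs_mul, abs_of_nonneg (hc0 j)]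
      by_cases hj : j < i
      · rw [if_pos (Finset.mem_range.2 hj), ← mul_add, add_sub_cancel]
        exact mul_le_mul_of_nonneg_left (hB j hj) (hc0 j)
      · rw [if_neg (by simpa using hj), add_zero]
        exact mul_le_mul_of_nonneg_left (hδ j (not_lt.1 hj)) (hc0 j)
    rw [hdiff.tsum_eq, ← Finset.sum_mul, ← hq, Real.norm_eq_abs] at hle
    calc _ ≤ _ := hle
      _ = q ^ (k + 1) * (2 * C) + δ := by rw [hBdef]; ring

/-- for a semidirect product with amenable (Følner) A, the affine action on A
admits a non-degenerate Liouville measure. -/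
theorem stmt11 {A G : Type*} [Group A] [Group G] [Countable A] [Countable G] [DecidableEq A]
    (φ : G →* MulAut A)
    (hFol : ∀ (K : Finset A) (ε : ℝ), 0 < ε →
      ∃ F : Finset A, F.Nonempty ∧
        ∀ k ∈ K, ((symmDiff (F.image (fun a => k * a)) F).card : ℝ) ≤ ε * F.card) :
    ∃ μ : A ⋊[φ] G → ℝ, IsProb μ ∧ Subgroup.closure (Function.support μ) = ⊤ ∧
      ∀ h : A → ℝ, BoundedFn h →
        (∀ x : A, h x = ∑' y : A, sdK φ μ x y * h y) →
        ∀ x y : A, h x = h y := by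
  obtain ⟨a, ha⟩ := exists_surjective_nat A
  have : Countable (A ⋊[φ] G) := SemidirectProduct.equivProd.injective.countable
  obtain ⟨g, hg⟩ := exists_surjective_nat (A ⋊[φ] G)
  obtain ⟨c, hcpos, hc1⟩ : ∃ c : ℕ → ℝ, (∀ j, 0 < c j) ∧ HasSum c 1 :=
    ⟨_, fun j => by positivity, hasSum_geometric_two' 1⟩
  let η : ℕ → ℝ := fun j => 1 / ((j : ℝ) + 1)
  have hη0 : ∀ j, 0 < η j := fun j => Nat.one_div_pos_of_nat
  have hη1 : ∀ j, η j ≤ 1 := fun j => by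
    simpa [η] using Nat.one_div_le_one_div (α := ℝ) (Nat.zero_le j)
  have hηanti : Antitone η := fun i j hij => Nat.one_div_le_one_div hij
  have hq1 : ∀ i, ∑ j ∈ Finset.range i, c j < 1 := fun i => by
    have := sum_le_hasSum (Finset.range (i + 1)) (fun j _ => (hcpos j).le) hc1
    rw [Finset.sum_range_succ] at this
    linarith [hcpos i]
  choose N hN using fun i => exists_pow_lt_of_lt_one (hη0 i) (hq1 i)
  let σ : ℕ → A → A := fun j x => (g j).left * φ (g j).right x
  obtain ⟨F, K, hKmono, hFK⟩ := exists_folner_sequence hFol a N σ hη0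
  have hFne : ∀ j, (F j).Nonempty := fun j => (hFK j).1
  have hFcard : ∀ j, (0 : ℝ) < (F j).card := fun j => by exact_mod_cast (hFne j).card_pos
  let p : (Σ j, Option (F j)) → ℝ :=
    fun i => c i.1 * i.2.elim (η i.1) (fun _ => (1 - η i.1) / (F i.1).card)
  let s : (Σ j, Option (F j)) → A ⋊[φ] G :=
    fun i => i.2.elim (g i.1) (fun f => SemidirectProduct.inl (f : A)⁻¹)
  have hp0 : ∀ i, 0 ≤ p i := by
    rintro ⟨j, _ | f⟩
    · exact mul_nonneg (hcpos j).le (hη0 j).le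
    · exact mul_nonneg (hcpos j).le (div_nonneg (sub_nonneg.2 (hη1 j)) (hFcard j).le)
  have hfib : ∀ (f : A ⋊[φ] G → ℝ) (j : ℕ), HasSum (fun o => p ⟨j, o⟩ * f (s ⟨j, o⟩))
      (c j * (η j * f (g j) + (1 - η j) / (F j).card *
        ∑ b ∈ F j, f (SemidirectProduct.inl b⁻¹))) := fun f j => by
    convert hasSum_fintype _ using 1
    rw [Fintype.sum_option, ← Finset.sum_coe_sort (F j), mul_add, Finset.mul_sum, Finset.mul_sum]
    simp only [p, s, Option.elim, mul_assoc]
  have hfib1 : ∀ j, HasSum (fun o => p ⟨j, o⟩) (c j) := fun j => by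
    have h1 := hfib (fun _ => 1) j
    simp only [mul_one, Finset.sum_const, nsmul_eq_mul, div_mul_cancel₀ _ (hFcard j).ne',
      add_sub_cancel] at h1
    exact h1
  have hpsum : HasSum p 1 := by
    have hs : Summable p := (summable_sigma_of_nonneg hp0).2
      ⟨fun j => (hfib1 j).summable, by simpa only [(hfib1 _).tsum_eq] using hc1.summable⟩
    have := hs.hasSum.sigma hfib1
    exact hc1.unique this ▸ hs.hasSum
  let μ : A ⋊[φ] G → ℝ := pushWeight p s
  have hμ0 : ∀ w, 0 ≤ μ w := pushWeight_nonneg hp0 s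
  have hμ1 : HasSum μ 1 := by
    simpa only [mul_one, hpsum.tsum_eq] using
      hasSum_pushWeight_mul hp0 hpsum.summable s (f := fun _ => 1) (C := 1) (by simp)
  have hμg : ∀ w, μ w ≠ 0 := fun w => by
    obtain ⟨j, rfl⟩ := hg w
    have hle : c j * η j ≤ μ (g j) := le_pushWeight hp0 hpsum.summable s ⟨j, none⟩
    exact ((mul_pos (hcpos j) (hη0 j)).trans_le hle).ne'
  refine ⟨μ, ⟨hμ0, hμ1⟩, ?_, ?_⟩
  · rw [Function.support_eq_univ hμg, Subgroup.closure_univ]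
  rintro h ⟨C, hC⟩ hharm
  have hC0 : 0 ≤ C := (abs_nonneg _).trans (hC 1)
  have hP : ∀ x, HasSum (fun j => c j * mixedAverage h (η j) (σ j) (F j) x) (h x) := fun x => by
    let f : A ⋊[φ] G → ℝ := fun w => h (w.left * φ w.right x)
    have hf : ∀ w, |f w| ≤ C := fun w => hC _
    have h1 : h x = ∑' w, μ w * f w := by
      rw [hharm x]
      exact (hasSum_pushWeight_mul hμ0 hμ1.summable
        (fun w : A ⋊[φ] G => w.left * φ w.right x) hC).tsum_eq
    have h2 : ∑' w, μ w * f w = ∑' i, p i * f (s i) :=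
      (hasSum_pushWeight_mul hp0 hpsum.summable s hf).tsum_eq
    have h3 : Summable (fun i => p i * f (s i)) :=
      summable_mul_of_bounded hp0 hpsum.summable fun i => hf _
    have h4 := h3.hasSum.sigma (hfib f)
    rw [← h2, ← h1] at h4
    simpa [mixedAverage, f, σ] using h4
  intro x y
  obtain ⟨ix, rfl⟩ := ha x
  obtain ⟨iy, rfl⟩ := ha y
  have hbound : ∀ i, max ix iy ≤ i → |h (a ix) - h (a iy)| ≤ 6 * C * η i := fun i hi => by
    obtain ⟨-, -, T, hT0, hTmono, hTK, hTstep⟩ := hFK i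
    have := abs_sub_le_of_chain (fun j => (hcpos j).le) hc1 hC hP (i := i) (n := N i) (T := T)
      (δ := 4 * C * η i)
      (fun m hm u hu v hv j hj => by
        have hsub : T m ⊆ K j := ((hTmono hm).trans hTK).trans (hKmono hj)
        refine (abs_mixedAverage_sub_le_of_folner hC (hFne j) (hη0 j).le (hη1 j)
          ((hFK j).2.1 u (hsub hu)) ((hFK j).2.1 v (hsub hv))).trans ?_
        exact mul_le_mul_of_nonneg_left (hηanti hj) (by positivity))
      (fun m u hu v hv B hB j hj =>
        abs_mixedAverage_sub_le (hFne j) (hη0 j).le (hη1 j)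
          (hB _ (hTstep j hj m u hu).1 _ (hTstep j hj m v hv).1)
          fun f hf => hB _ ((hTstep j hj m u hu).2 f hf) _ ((hTstep j hj m v hv).2 f hf))
      (N i) 0 (zero_add _) (a ix) (hT0 ix (le_of_max_le_left hi)) (a iy)
      (hT0 iy (le_of_max_le_right hi))
    have h2 := mul_le_mul_of_nonneg_right (hN i).le (by positivity : 0 ≤ 2 * C)
    linarith
  have hlim : Tendsto (fun i => 6 * C * η i) atTop (nhds 0) := by
    simpa [η] using (tendsto_one_div_add_atTop_nhds_zero_nat (𝕜 := ℝ)).const_mul (6 * C)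
  have hzero : |h (a ix) - h (a iy)| ≤ 0 :=
    ge_of_tendsto hlim (eventually_atTop.2 ⟨_, hbound⟩)
  exact sub_eq_zero.1 (abs_nonpos_iff.1 hzero)
end
end

section
/- Let G be a countable amenable group acting on a countable set X. Then there exists a non-degenerate (possibly infinitely supported) probability measure μ on G such that every bounded P_μ-harmonic function on X is constant. -/
open scoped Classical
open Filter

noncomputable section

variable {G : Type*} [Group G] {X : Type*} [MulAction G X]

/-- On a finite set `F`, the weights `w` are those of a probability measure whose averages move by
at most `ε * C` when a function bounded by `C` is translated by an element of `K`. -/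
structure AlmostInvariant {G : Type*} [Group G] (w : G → ℝ) (F K : Finset G) (ε : ℝ) : Prop where
  nonneg : ∀ g, 0 ≤ w g
  eq_zero : ∀ g ∉ F, w g = 0
  sum_eq : ∑ g ∈ F, w g = 1
  invariant : ∀ k ∈ K, ∀ (f : G → ℝ) (C : ℝ), (∀ g, |f g| ≤ C) →
    |∑ g ∈ F, w g * (f (g * k) - f g)| ≤ ε * C

theorem summable_mul_of_abs_le {ι : Type*} {ν f : ι → ℝ} {C : ℝ} (hν : Summable ν)
    (h0 : ∀ i, 0 ≤ ν i) (hf : ∀ i, |f i| ≤ C) : Summable fun i => ν i * f i := by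
  refine Summable.of_norm_bounded (hν.mul_right C) fun i => ?_
  rw [Real.norm_eq_abs, abs_mul, abs_of_nonneg (h0 i)]
  exact mul_le_mul_of_nonneg_left (hf i) (h0 i)

theorem abs_sum_mul_le {ι : Type*} (s : Finset ι) {w f : ι → ℝ} {C : ℝ}
    (h0 : ∀ i ∈ s, 0 ≤ w i) (hf : ∀ i ∈ s, |f i| ≤ C) :
    |∑ i ∈ s, w i * f i| ≤ (∑ i ∈ s, w i) * C := by
  rw [Finset.sum_mul]
  refine (Finset.abs_sum_le_sum_abs _ _).trans (Finset.sum_le_sum fun i hi => ?_)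
  rw [abs_mul, abs_of_nonneg (h0 i hi)]
  exact mul_le_mul_of_nonneg_left (hf i hi) (h0 i hi)

/-- Restricting a probability measure to a finite set changes the integral of a function bounded
by `C` by at most `C` times the mass left out. -/
theorem abs_sum_sub_tsum_le {ι : Type*} {ν f : ι → ℝ} {C : ℝ} (hν : HasSum ν 1)
    (h0 : ∀ i, 0 ≤ ν i) (hf : ∀ i, |f i| ≤ C) (F : Finset ι) :
    |∑ i ∈ F, ν i * f i - ∑' i, ν i * f i| ≤ (1 - ∑ i ∈ F, ν i) * C := by
  have hs := (summable_mul_of_abs_le hν.summable h0 hf).hasSum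
  have h1 := sum_le_hasSum F
    (fun i _ => by nlinarith [h0 i, abs_le.1 (hf i)] : ∀ i ∉ F, 0 ≤ ν i * C - ν i * f i)
    ((hν.mul_right C).sub hs)
  have h2 := sum_le_hasSum F
    (fun i _ => by nlinarith [h0 i, abs_le.1 (hf i)] : ∀ i ∉ F, 0 ≤ ν i * C + ν i * f i)
    ((hν.mul_right C).add hs)
  rw [Finset.sum_sub_distrib, ← Finset.sum_mul] at h1
  rw [Finset.sum_add_distrib, ← Finset.sum_mul] at h2
  rw [abs_le]
  constructor <;> linarith

/-- The inversion of an almost left-invariant measure has almost right-invariant averages. -/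
theorem abs_tsum_mul_translate_sub_le {G : Type*} [Group G] {ν : G → ℝ} (hν : IsProb ν)
    {k : G} {ε : ℝ} (hk : ∑' h : G, |ν (k * h) - ν h| ≤ ε) {f : G → ℝ} {C : ℝ}
    (hf : ∀ g, |f g| ≤ C) : |∑' h, ν h * (f (h⁻¹ * k) - f h⁻¹)| ≤ ε * C := by
  have hC : 0 ≤ C := (abs_nonneg _).trans (hf 1)
  have hs1 : Summable fun h => ν h * f (h⁻¹ * k) :=
    summable_mul_of_abs_le hν.2.summable hν.1 fun _ => hf _
  have hs2 : Summable fun h => ν h * f h⁻¹ :=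
    summable_mul_of_abs_le hν.2.summable hν.1 fun _ => hf _
  have hνk : Summable fun h => ν (k * h) := hν.2.summable.comp_injective (mul_right_injective k)
  have hs3 : Summable fun h => ν (k * h) * f h⁻¹ :=
    summable_mul_of_abs_le hνk (fun _ => hν.1 _) fun _ => hf _
  have hshift : ∑' h, ν h * f (h⁻¹ * k) = ∑' h, ν (k * h) * f h⁻¹ := by
    rw [← (Equiv.mulLeft k).tsum_eq]
    simp
  have heq : ∑' h, ν h * (f (h⁻¹ * k) - f h⁻¹) = ∑' h, (ν (k * h) - ν h) * f h⁻¹ := by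
    simp only [mul_sub, sub_mul]
    rw [hs1.tsum_sub hs2, hs3.tsum_sub hs2, hshift]
  have hd : Summable fun h => |ν (k * h) - ν h| := (hνk.sub hν.2.summable).abs
  rw [heq]
  calc |∑' h, (ν (k * h) - ν h) * f h⁻¹| ≤ ∑' h, |ν (k * h) - ν h| * C := by
        rw [← Real.norm_eq_abs]
        refine tsum_of_norm_bounded (hd.mul_right C).hasSum fun h => ?_
        rw [Real.norm_eq_abs, abs_mul]
        exact mul_le_mul_of_nonneg_left (hf _) (abs_nonneg _)
    _ ≤ ε * C := by
        rw [tsum_mul_right]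
        exact mul_le_mul_of_nonneg_right hk hC

theorem exists_almostInvariant {G : Type*} [Group G]
    (hAm : ∀ (K : Finset G) (ε : ℝ), 0 < ε →
      ∃ ν : G → ℝ, IsProb ν ∧ ∀ g ∈ K, ∑' h : G, |ν (g⁻¹ * h) - ν h| ≤ ε)
    (K : Finset G) {ε : ℝ} (hε : 0 < ε) :
    ∃ (w : G → ℝ) (F : Finset G), AlmostInvariant w F K ε := by
  obtain ⟨ν, hν, hinv⟩ := hAm (K.image (·⁻¹)) (ε / 4) (by positivity)
  obtain ⟨F, hF⟩ := ((hν.2.eventually (lt_mem_nhds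
    (show max (1 / 2) (1 - ε / 8) < (1 : ℝ) by
      rw [max_lt_iff]; constructor <;> linarith))).exists)
  obtain ⟨hF1, hF2⟩ := max_lt_iff.1 hF
  set m := ∑ g ∈ F, ν g with hm
  have hm0 : 0 < m := by linarith
  have hm0' : m ≠ 0 := hm0.ne'
  have hsum : ∀ φ : G → ℝ, ∑ g ∈ F.image (·⁻¹), (if g⁻¹ ∈ F then ν g⁻¹ / m else 0) * φ g =
      (∑ g ∈ F, ν g * φ g⁻¹) / m := by
    intro φ
    rw [Finset.sum_image inv_injective.injOn, Finset.sum_div]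
    refine Finset.sum_congr rfl fun g hg => ?_
    rw [inv_inv, if_pos hg]
    ring
  refine ⟨fun g => if g⁻¹ ∈ F then ν g⁻¹ / m else 0, F.image (·⁻¹), ?_, ?_, ?_, ?_⟩
  · intro g
    split_ifs
    · exact div_nonneg (hν.1 _) hm0.le
    · exact le_rfl
  · intro g hg
    refine if_neg fun h => hg (Finset.mem_image.2 ⟨_, h, inv_inv g⟩)
  · simpa [← hm, hm0'] using hsum fun _ => 1
  · intro k hk f C hf
    have hC : 0 ≤ C := (abs_nonneg _).trans (hf 1)
    have h1 := abs_tsum_mul_translate_sub_le hν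
      (by simpa using hinv k⁻¹ (Finset.mem_image_of_mem _ hk)) hf
    have h2 := abs_sum_sub_tsum_le hν.2 hν.1 (f := fun h => f (h⁻¹ * k) - f h⁻¹) (C := 2 * C)
      (fun h => (abs_sub _ _).trans (by linarith [hf (h⁻¹ * k), hf h⁻¹])) F
    rw [hsum fun g => f (g * k) - f g, abs_div, abs_of_pos hm0, div_le_iff₀ hm0]
    rw [← hm] at h2
    rw [abs_le] at h1 h2 ⊢
    have h3 : (1 - m) * (2 * C) ≤ ε / 8 * (2 * C) :=
      mul_le_mul_of_nonneg_right (by linarith) (by linarith)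
    have h4 : ε * C * (1 / 2) ≤ ε * C * m := mul_le_mul_of_nonneg_left hF1.le (by positivity)
    constructor <;> linarith

/-- Almost invariant weights may be chosen to charge a prescribed element. -/
theorem exists_almostInvariant_pos {G : Type*} [Group G]
    (hAm : ∀ (K : Finset G) (ε : ℝ), 0 < ε →
      ∃ ν : G → ℝ, IsProb ν ∧ ∀ g ∈ K, ∑' h : G, |ν (g⁻¹ * h) - ν h| ≤ ε)
    (K : Finset G) (c : G) {ε : ℝ} (hε : 0 < ε) :
    ∃ (w : G → ℝ) (F : Finset G), AlmostInvariant w F K ε ∧ 0 < w c := by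
  obtain ⟨v, F, hv⟩ := exists_almostInvariant hAm K (half_pos hε)
  obtain ⟨η, hη0, hη1, hηε⟩ : ∃ η : ℝ, 0 < η ∧ η ≤ 1 ∧ η ≤ ε / 4 :=
    ⟨min 1 (ε / 4), lt_min one_pos (by positivity), min_le_left _ _, min_le_right _ _⟩
  have hsum : ∀ φ : G → ℝ,
      ∑ g ∈ insert c F, ((1 - η) * v g + if g = c then η else 0) * φ g =
        (1 - η) * ∑ g ∈ F, v g * φ g + η * φ c := by
    intro φ
    have hins : ∑ g ∈ F, v g * φ g = ∑ g ∈ insert c F, v g * φ g :=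
      Finset.sum_subset (Finset.subset_insert _ _) fun g _ hg => by rw [hv.eq_zero g hg, zero_mul]
    simp only [add_mul, Finset.sum_add_distrib, ite_mul, zero_mul, Finset.sum_ite_eq',
      Finset.mem_insert_self, if_true, hins, Finset.mul_sum, mul_assoc]
  refine ⟨fun g => (1 - η) * v g + if g = c then η else 0, insert c F, ⟨?_, ?_, ?_, ?_⟩, ?_⟩
  · intro g
    have := mul_nonneg (sub_nonneg.2 hη1) (hv.nonneg g)
    split_ifs <;> linarith
  · intro g hg
    rw [Finset.mem_insert, not_or] at hg
    simp [hv.eq_zero g hg.2, hg.1]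
  · simpa [hv.sum_eq] using hsum fun _ => 1
  · intro k hk f C hf
    have h1 := hv.invariant k hk f C hf
    rw [hsum fun g => f (g * k) - f g]
    have h2 := abs_le.1 (hf (c * k))
    have h3 := abs_le.1 (hf c)
    have hC : 0 ≤ C := (abs_nonneg _).trans (hf 1)
    have h4 : (1 - η) * |∑ g ∈ F, v g * (f (g * k) - f g)| ≤ ε / 2 * C :=
      (mul_le_of_le_one_left (abs_nonneg _) (by linarith)).trans h1
    have h5 : η * |f (c * k) - f c| ≤ ε / 4 * (2 * C) :=
      mul_le_mul hηε (abs_le.2 ⟨by linarith, by linarith⟩) (abs_nonneg _) (by positivity)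
    refine (abs_add_le _ _).trans ?_
    rw [abs_mul, abs_mul, abs_of_nonneg (sub_nonneg.2 hη1), abs_of_pos hη0]
    linarith
  · have := mul_nonneg (sub_nonneg.2 hη1) (hv.nonneg c)
    simp only [if_true]
    linarith

open scoped Pointwise in
/-- If `h = A h + b`, where `A` averages over `T` with total mass `s` and `b` is close to
`(1 - s) * c` along the words of length `n` in `T`, then `h` is close to `c`. -/
theorem abs_sub_le_of_approx_solution {G X : Type*} [Group G] [MulAction G X] {T : Finset G}
    (hT : 1 ∈ T) {α : G → ℝ} (hα : ∀ g ∈ T, 0 ≤ α g) {s : ℝ} (hs : ∑ g ∈ T, α g = s)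
    {h : X → ℝ} {c δ M : ℝ} (hδ : 0 ≤ δ) (hM : ∀ x, |h x - c| ≤ M) (n : ℕ) :
    ∀ x : X, (∀ a ∈ T ^ n, |h (a • x) - ∑ g ∈ T, α g * h (g • a • x) - (1 - s) * c|
      ≤ (1 - s) * δ) → |h x - c| ≤ s ^ n * M + δ := by
  induction n with
  | zero =>
    intro x _
    rw [pow_zero, one_mul]
    linarith [hM x]
  | succ n ih =>
    intro x hx
    have h1 := hx 1 (Finset.one_mem_pow hT)
    rw [one_smul] at h1
    have h2 : |∑ g ∈ T, α g * (h (g • x) - c)| ≤ s * (s ^ n * M + δ) := by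
      rw [← hs]
      refine abs_sum_mul_le T hα fun g hg => ?_
      rw [hs]
      refine ih (g • x) fun a ha => ?_
      have h3 := hx (a * g) (by rw [pow_succ]; exact Finset.mul_mem_mul ha hg)
      rwa [mul_smul] at h3
    have h4 : h x - c = (h x - ∑ g ∈ T, α g * h (g • x) - (1 - s) * c)
        + ∑ g ∈ T, α g * (h (g • x) - c) := by
      simp only [mul_sub, Finset.sum_sub_distrib]
      rw [← Finset.sum_mul, hs]
      ring
    rw [h4]
    refine (abs_add_le _ _).trans ((add_le_add h1 h2).trans (le_of_eq ?_))
    ring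

open scoped Pointwise in
/-- A sequence of finitely supported weights, each almost invariant under long words in the
supports of the previous ones, which together charge every term of the sequence `e`. -/
theorem exists_almostInvariant_seq {G : Type*} [Group G]
    (hAm : ∀ (K : Finset G) (ε : ℝ), 0 < ε →
      ∃ ν : G → ℝ, IsProb ν ∧ ∀ g ∈ K, ∑' h : G, |ν (g⁻¹ * h) - ν h| ≤ ε)
    (e : ℕ → G) (n : ℕ → ℕ) :
    ∃ (w : ℕ → G → ℝ) (F T : ℕ → Finset G),
      (∀ i, 0 < w i (e i)) ∧ (∀ i, 1 ∈ T i) ∧ (∀ i, ∀ j < i, F j ⊆ T i ∧ e j ∈ T i) ∧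
      ∀ i, ∀ j ≥ i, AlmostInvariant (w j) (F j) (T i ^ (n i + 1)) ((1 / 2) ^ j) := by
  choose w F hwF hw using fun (K : Finset G) (i : ℕ) =>
    exists_almostInvariant_pos hAm K (e i) (ε := (1 / 2) ^ i) (by positivity)
  let T : ℕ → Finset G := fun i => Nat.rec {1} (fun i T =>
    insert 1 (insert (e i) (T ^ (n i + 1) ∪ F (T ^ (n i + 1)) i))) i
  have hsucc : ∀ i, T (i + 1) =
    insert 1 (insert (e i) (T i ^ (n i + 1) ∪ F (T i ^ (n i + 1)) i)) := fun _ => rfl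
  have hone : ∀ i, 1 ∈ T i := by
    rintro (_ | i)
    · exact Finset.mem_singleton_self _
    · rw [hsucc]
      exact Finset.mem_insert_self _ _
  have hsub : ∀ i, T i ⊆ T i ^ (n i + 1) := fun i => Finset.subset_pow (hone i) (by simp)
  have hpow : ∀ i, T i ^ (n i + 1) ⊆ T (i + 1) := fun i g hg => by
    rw [hsucc]
    simp [hg]
  have hmonoT : Monotone T := monotone_nat_of_le_succ fun i => (hsub i).trans (hpow i)
  have hmonoD : Monotone fun i => T i ^ (n i + 1) :=
    monotone_nat_of_le_succ fun i => (hpow i).trans (hsub (i + 1))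
  refine ⟨fun i => w (T i ^ (n i + 1)) i, fun i => F (T i ^ (n i + 1)) i, T, fun i => hw _ _,
    hone, fun i j hj => ⟨fun g hg => hmonoT hj ?_, hmonoT hj ?_⟩, fun i j hij => ?_⟩
  · change g ∈ T (j + 1)
    rw [hsucc]
    simp [hg]
  · change e j ∈ T (j + 1)
    rw [hsucc]
    simp
  · have h1 := hwF (T j ^ (n j + 1)) j
    exact ⟨h1.nonneg, h1.eq_zero, h1.sum_eq, fun k hk => h1.invariant k (hmonoD hij hk)⟩

theorem tsum_transK_mul {G : Type*} [Group G] {X : Type*} [MulAction G X] {μ : G → ℝ}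
    {h : X → ℝ} {x : X} {a : ℝ} (ha : HasSum (fun g => μ g * h (g • x)) a) :
    ∑' y, transK μ x y * h y = a := by
  rw [← (ha.tsum_fiberwise fun g => g • x).tsum_eq]
  refine tsum_congr fun y => ?_
  rw [tsum_subtype _ fun g => μ g * h (g • x), transK, pushMeas, ← tsum_mul_right]
  refine tsum_congr fun g => ?_
  by_cases hg : g • x = y
  · simp [Set.indicator, hg]
  · simp [Set.indicator, hg]

/-- Integrating a bounded function against a mixture of finitely supported measures. -/
theorem hasSum_mixture_mul {G : Type*} {t : ℕ → ℝ} (ht0 : ∀ j, 0 ≤ t j) (ht : Summable t)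
    {w : ℕ → G → ℝ} {F : ℕ → Finset G} (hw0 : ∀ j g, 0 ≤ w j g) (hwF : ∀ j, ∀ g ∉ F j, w j g = 0)
    (hw1 : ∀ j, ∑ g ∈ F j, w j g = 1) {φ : G → ℝ} {C : ℝ} (hφ : ∀ g, |φ g| ≤ C) :
    HasSum (fun g => (∑' j, t j * w j g) * φ g) (∑' j, t j * ∑ g ∈ F j, w j g * φ g) := by
  have hfib : ∀ (ψ : G → ℝ) (j : ℕ),
      HasSum (fun g => t j * w j g * ψ g) (t j * ∑ g ∈ F j, w j g * ψ g) := by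
    intro ψ j
    rw [Finset.mul_sum]
    simp only [← mul_assoc]
    exact hasSum_sum_of_ne_finset_zero fun g hg => by rw [hwF j g hg, mul_zero, zero_mul]
  have hbase : Summable fun p : ℕ × G => t p.1 * w p.1 p.2 := by
    have hfib1 : ∀ j, HasSum (fun g => t j * w j g) (t j) := fun j => by
      simpa [hw1] using hfib (fun _ => 1) j
    rw [summable_prod_of_nonneg fun p => mul_nonneg (ht0 _) (hw0 _ _)]
    refine ⟨fun j => (hfib1 j).summable, ?_⟩
    simpa only [(hfib1 _).tsum_eq] using ht
  have hprod : Summable fun p : ℕ × G => t p.1 * w p.1 p.2 * φ p.2 :=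
    summable_mul_of_abs_le hbase (fun p => mul_nonneg (ht0 _) (hw0 _ _)) fun p => hφ p.2
  have h1 := hprod.hasSum.prod_fiberwise fun j => hfib φ j
  have hswap := (Equiv.prodComm G ℕ).hasSum_iff.2 hprod.hasSum
  rw [h1.tsum_eq]
  refine hswap.prod_fiberwise fun g => ?_
  exact ((Equiv.prodComm G ℕ).summable_iff.2 hbase |>.prod_factor g).hasSum.mul_right (φ g)

theorem hasSum_half_pow_add (i : ℕ) :
    HasSum (fun j => (1 / 2 : ℝ) ^ (j + i + 1)) ((1 / 2) ^ i) := by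
  convert hasSum_geometric_two' ((1 / 2 : ℝ) ^ i) using 2 with j
  rw [pow_succ, pow_add, one_div_pow, one_div_pow]
  ring

theorem sum_half_pow_succ (i : ℕ) :
    ∑ j ∈ Finset.range i, (1 / 2 : ℝ) ^ (j + 1) = 1 - (1 / 2) ^ i := by
  induction i with
  | zero => simp
  | succ i ih =>
    rw [Finset.sum_range_succ, ih]
    ring

open scoped Pointwise in
/-- A bounded solution of `h = ∑ j, 2 ^ (-j - 1) * P_j h`, where `P_j` averages along `w j`, is
almost invariant under `k` as soon as the `w j` with `j ≥ i` are almost invariant under the words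
of length `n + 1` in a set containing `k` and the supports of the `w j` with `j < i`. -/
theorem abs_sub_le_of_mixture_harmonic {G X : Type*} [Group G] [MulAction G X]
    {w : ℕ → G → ℝ} {F : ℕ → Finset G} {T : Finset G} {i n : ℕ} (hT : 1 ∈ T)
    (hn : (1 - (1 / 2 : ℝ) ^ i) ^ n ≤ (1 / 2) ^ i) (hw0 : ∀ j g, 0 ≤ w j g)
    (hwF : ∀ j, ∀ g ∉ F j, w j g = 0) (hw1 : ∀ j, ∑ g ∈ F j, w j g = 1)
    (hFT : ∀ j < i, F j ⊆ T)
    (hinv : ∀ j ≥ i, AlmostInvariant (w j) (F j) (T ^ (n + 1)) ((1 / 2) ^ j))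
    {h : X → ℝ} {C : ℝ} (hC : ∀ x, |h x| ≤ C)
    (hh : ∀ x, h x = ∑' j, (1 / 2 : ℝ) ^ (j + 1) * ∑ g ∈ F j, w j g * h (g • x))
    (x : X) {k : G} (hk : k ∈ T) : |h x - h (k • x)| ≤ 6 * C * (1 / 2) ^ i := by
  have hC0 : 0 ≤ C := (abs_nonneg _).trans (hC x)
  set q : X → ℕ → ℝ := fun z j => ∑ g ∈ F j, w j g * h (g • z)
  have hqC : ∀ z j, |q z j| ≤ C := fun z j => by
    simpa [hw1] using abs_sum_mul_le (F j) (fun g _ => hw0 j g) fun g _ => hC (g • z)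
  have hsum : ∀ z, Summable fun j => (1 / 2 : ℝ) ^ (j + 1) * q z j := fun z =>
    summable_mul_of_abs_le (by simpa using (hasSum_half_pow_add 0).summable)
      (fun j => by positivity) (hqC z)
  set α : G → ℝ := fun g => ∑ j ∈ Finset.range i, (1 / 2 : ℝ) ^ (j + 1) * w j g with hα
  have hαsum : ∀ φ : G → ℝ, ∑ g ∈ T, α g * φ g =
      ∑ j ∈ Finset.range i, (1 / 2 : ℝ) ^ (j + 1) * ∑ g ∈ F j, w j g * φ g := by
    intro φ
    simp only [hα, Finset.sum_mul]
    rw [Finset.sum_comm]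
    refine Finset.sum_congr rfl fun j hj => ?_
    rw [Finset.sum_subset (hFT j (Finset.mem_range.1 hj)) fun g _ hg => by
      rw [hwF j g hg, zero_mul], Finset.mul_sum]
    exact Finset.sum_congr rfl fun g _ => mul_assoc _ _ _
  have hs : ∑ g ∈ T, α g = 1 - (1 / 2) ^ i := by
    simpa only [mul_one, hw1, sum_half_pow_succ] using hαsum fun _ => 1
  set b : X → ℝ := fun z => h z - ∑ g ∈ T, α g * h (g • z)
  have htail : ∀ z, HasSum (fun j => (1 / 2 : ℝ) ^ (j + i + 1) * q z (j + i)) (b z) := by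
    intro z
    change HasSum _ (h z - ∑ g ∈ T, α g * h (g • z))
    rw [hαsum fun g => h (g • z), hh z, ← (hsum z).sum_add_tsum_nat_add i, add_sub_cancel_left]
    exact ((summable_nat_add_iff i).2 (hsum z)).hasSum
  have hbC : |b x| ≤ (1 / 2) ^ i * C := by
    rw [← (htail x).tsum_eq, ← Real.norm_eq_abs]
    refine tsum_of_norm_bounded ((hasSum_half_pow_add i).mul_right C) fun j => ?_
    rw [Real.norm_eq_abs, abs_mul, abs_of_nonneg (by positivity)]
    exact mul_le_mul_of_nonneg_left (hqC _ _) (by positivity)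
  have hbb : ∀ a ∈ T ^ (n + 1), |b (a • x) - b x| ≤ (1 / 2) ^ i * ((1 / 2) ^ i * C) := by
    intro a ha
    rw [← ((htail (a • x)).sub (htail x)).tsum_eq, ← Real.norm_eq_abs]
    refine tsum_of_norm_bounded ((hasSum_half_pow_add i).mul_right _) fun j => ?_
    rw [← mul_sub, Real.norm_eq_abs, abs_mul, abs_of_nonneg (by positivity)]
    refine mul_le_mul_of_nonneg_left ?_ (by positivity)
    have h1 := (hinv (j + i) (by simp)).invariant a ha (fun g => h (g • x)) C fun g => hC _
    simp only [mul_sub, Finset.sum_sub_distrib, mul_smul] at h1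
    refine h1.trans (mul_le_mul_of_nonneg_right ?_ hC0)
    exact pow_le_pow_of_le_one (by norm_num) (by norm_num) (by simp)
  have hp : (0 : ℝ) < (1 / 2) ^ i := by positivity
  obtain ⟨c, hc⟩ : ∃ c, (1 / 2) ^ i * c = b x := ⟨b x / (1 / 2) ^ i, by field_simp⟩
  have hcC : |c| ≤ C := by
    rw [← hc, abs_mul, abs_of_pos hp] at hbC
    exact le_of_mul_le_mul_left hbC hp
  have hclose : ∀ z, (∀ a ∈ T ^ n, ∃ a' ∈ T ^ (n + 1), a • z = a' • x) →
      |h z - c| ≤ 3 * C * (1 / 2) ^ i := by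
    intro z hz
    refine (abs_sub_le_of_approx_solution hT (fun g _ => Finset.sum_nonneg fun j _ =>
      mul_nonneg (by positivity) (hw0 j g)) hs (c := c) (δ := (1 / 2) ^ i * C) (M := 2 * C)
      (by positivity) (fun y => (abs_sub _ _).trans (by linarith [hC y])) n z
      fun a ha => ?_).trans ?_
    · obtain ⟨a', ha', hEq⟩ := hz a ha
      rw [hEq, sub_sub_cancel, hc]
      exact hbb a' ha'
    · have := mul_le_mul_of_nonneg_right hn (by linarith : 0 ≤ 2 * C)
      linarith
  have h1 := hclose x fun a ha =>
    ⟨a, Finset.pow_subset_pow_right hT n.le_succ ha, rfl⟩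
  have h2 := hclose (k • x) fun a ha =>
    ⟨a * k, by rw [pow_succ]; exact Finset.mul_mem_mul ha hk, (mul_smul _ _ _).symm⟩
  rw [abs_le] at h1 h2 ⊢
  constructor <;> linarith

/-- every transitive action of a countable amenable group admits a
non-degenerate Liouville measure. -/
theorem stmt12 {G : Type*} [Group G] [Countable G] {X : Type*} [MulAction G X] [Countable X]
    (hAm : ∀ (K : Finset G) (ε : ℝ), 0 < ε →
      ∃ ν : G → ℝ, IsProb ν ∧ ∀ g ∈ K, ∑' h : G, |ν (g⁻¹ * h) - ν h| ≤ ε)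
    (htrans : ∀ x y : X, ∃ g : G, g • x = y) :
    ∃ μ : G → ℝ, IsProb μ ∧ Subgroup.closure (Function.support μ) = ⊤ ∧
      ∀ h : X → ℝ, BoundedFn h → IsHarmonic (transK μ) h → ∀ x y : X, h x = h y := by
  obtain ⟨e, he⟩ := exists_surjective_nat G
  have hn : ∀ i : ℕ, ∃ n : ℕ, (1 - (1 / 2 : ℝ) ^ i) ^ n ≤ (1 / 2) ^ i := fun i => by
    have hp : (0 : ℝ) < (1 / 2) ^ i := by positivity
    obtain ⟨n, hn⟩ := exists_pow_lt_of_lt_one hp (show 1 - (1 / 2 : ℝ) ^ i < 1 by linarith)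
    exact ⟨n, hn.le⟩
  choose n hn using hn
  obtain ⟨w, F, T, hwe, hT, hFT, hinv⟩ := exists_almostInvariant_seq hAm e n
  have hw0 : ∀ j g, 0 ≤ w j g := fun j => (hinv j j le_rfl).nonneg
  have hwF : ∀ j, ∀ g ∉ F j, w j g = 0 := fun j => (hinv j j le_rfl).eq_zero
  have hw1 : ∀ j, ∑ g ∈ F j, w j g = 1 := fun j => (hinv j j le_rfl).sum_eq
  have ht : HasSum (fun j => (1 / 2 : ℝ) ^ (j + 1)) 1 := by simpa using hasSum_half_pow_add 0
  have hmix : ∀ (φ : G → ℝ) (C : ℝ), (∀ g, |φ g| ≤ C) →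
      HasSum (fun g => (∑' j, (1 / 2 : ℝ) ^ (j + 1) * w j g) * φ g)
        (∑' j, (1 / 2 : ℝ) ^ (j + 1) * ∑ g ∈ F j, w j g * φ g) := fun φ C hφ =>
    hasSum_mixture_mul (fun j => by positivity) ht.summable hw0 hwF hw1 hφ
  have hw_le : ∀ j g, |w j g| ≤ 1 := fun j g => by
    rw [abs_of_nonneg (hw0 j g)]
    by_cases hg : g ∈ F j
    · rw [← hw1 j]
      exact Finset.single_le_sum (fun g _ => hw0 j g) hg
    · rw [hwF j g hg]
      exact zero_le_one
  have hpos : ∀ g, 0 < ∑' j, (1 / 2 : ℝ) ^ (j + 1) * w j g := fun g => by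
    obtain ⟨l, rfl⟩ := he g
    exact (summable_mul_of_abs_le ht.summable (fun j => by positivity) fun j =>
      hw_le j (e l)).tsum_pos (fun j => mul_nonneg (by positivity) (hw0 j _)) l
      (mul_pos (by positivity) (hwe l))
  refine ⟨fun g => ∑' j, (1 / 2 : ℝ) ^ (j + 1) * w j g, ⟨fun g => (hpos g).le, ?_⟩, ?_, ?_⟩
  · simpa only [mul_one, hw1, ht.tsum_eq] using hmix (fun _ => 1) 1 (by simp)
  · rw [Function.support_eq_univ fun g => (hpos g).ne', Subgroup.closure_univ]
  · rintro h ⟨C, hC⟩ hh x y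
    obtain ⟨k, rfl⟩ := htrans x y
    obtain ⟨l, rfl⟩ := he k
    have hh' : ∀ x, h x = ∑' j, (1 / 2 : ℝ) ^ (j + 1) * ∑ g ∈ F j, w j g * h (g • x) :=
      fun x => (hh x).trans (tsum_transK_mul (hmix (fun g => h (g • x)) C fun g => hC _))
    have hbound : ∀ i > l, |h x - h (e l • x)| ≤ 6 * C * (1 / 2) ^ i := fun i hi =>
      abs_sub_le_of_mixture_harmonic (hT i) (hn i) hw0 hwF hw1 (fun j hj => (hFT i j hj).1)
        (hinv i) hC hh' x (hFT i l hi).2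
    have hlim : Tendsto (fun i : ℕ => 6 * C * (1 / 2 : ℝ) ^ i) atTop (nhds 0) := by
      simpa using (tendsto_pow_atTop_nhds_zero_of_lt_one (r := (1 / 2 : ℝ)) (by norm_num)
        (by norm_num)).const_mul (6 * C)
    have h0 := ge_of_tendsto hlim ((eventually_gt_atTop l).mono hbound)
    exact sub_eq_zero.1 (abs_nonpos_iff.1 h0)
end
end

section
/- Let P be an irreducible Markov kernel on a countable set X that is lazy, P(x,x) ≥ 1/2 for all x. Then for all x, y ∈ X, ‖P^n(x,·) − P^{n+1}(x,·)‖₁ → 0 as n → ∞ (the lazy chain is aperiodic and its consecutive-time distributions merge). -/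
open scoped Classical
open Filter

noncomputable section

variable {G : Type*} [Group G] {X : Type*} [MulAction G X]

/-- Every row of the `n`-step kernel of a stochastic kernel is a probability vector. -/
theorem kpow_stochastic {Y : Type*} {Q : Y → Y → ℝ}
    (hQ : ∀ x : Y, (∀ y, 0 ≤ Q x y) ∧ HasSum (Q x) 1) (n : ℕ) (x : Y) :
    (∀ y, 0 ≤ kpow Q n x y) ∧ HasSum (kpow Q n x) 1 := by
  induction n generalizing x with
  | zero =>
    refine ⟨fun y => by simp only [kpow]; split_ifs <;> norm_num, ?_⟩
    simpa only [kpow, eq_comm] using hasSum_ite_eq x (1 : ℝ)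
  | succ n ih =>
    have h_nonneg : ∀ p : Y × Y, 0 ≤ Q x p.1 * kpow Q n p.1 p.2 :=
      fun p => mul_nonneg ((hQ x).1 _) ((ih _).1 _)
    have h_row : ∀ z, HasSum (fun y => Q x z * kpow Q n z y) (Q x z) := fun z => by
      simpa using (ih z).2.mul_left (Q x z)
    have h_summable : Summable fun p : Y × Y => Q x p.1 * kpow Q n p.1 p.2 := by
      refine (summable_prod_of_nonneg h_nonneg).2 ⟨fun z => (h_row z).summable, ?_⟩
      simpa only [(h_row _).tsum_eq] using (hQ x).2.summable
    have h_total : HasSum (fun p : Y × Y => Q x p.1 * kpow Q n p.1 p.2) 1 := by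
      have h := h_summable.hasSum
      rwa [(h.prod_fiberwise h_row).unique (hQ x).2] at h
    have h_swap := (Equiv.prodComm Y Y).hasSum_iff.2 h_total
    exact ⟨fun y => tsum_nonneg fun z => h_nonneg (z, y),
      h_swap.prod_fiberwise fun y => (h_swap.summable.prod_factor y).hasSum⟩

theorem summable_mul_kpow {Y : Type*} {Q : Y → Y → ℝ}
    (hQ : ∀ x : Y, (∀ y, 0 ≤ Q x y) ∧ HasSum (Q x) 1) (n : ℕ) (x y : Y) :
    Summable fun z => Q x z * kpow Q n z y := by
  refine (hQ x).2.summable.of_nonneg_of_le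
    (fun z => mul_nonneg ((hQ x).1 z) ((kpow_stochastic hQ n z).1 y)) fun z => ?_
  have h := kpow_stochastic hQ n z
  exact mul_le_of_le_one_right ((hQ x).1 z) (le_hasSum h.2 y fun w _ => h.1 w)

/-- Binomial expansion of the powers of `(1 + Q) / 2`. -/
theorem kpow_lazy_eq_sum {Y : Type*} {P Q : Y → Y → ℝ}
    (hQ : ∀ x : Y, (∀ y, 0 ≤ Q x y) ∧ HasSum (Q x) 1)
    (hPQ : ∀ x y, P x y = ((if x = y then 1 else 0) + Q x y) / 2) (n : ℕ) (x y : Y) :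
    kpow P n x y = ∑ k ∈ Finset.range (n + 1), (n.choose k : ℝ) / 2 ^ n * kpow Q k x y := by
  induction n generalizing x with
  | zero => simp [kpow]
  | succ n ih =>
    have h_diag : HasSum (fun z => (if x = z then 1 else 0) * kpow P n z y) (kpow P n x y) := by
      convert hasSum_ite_eq x (kpow P n x y) using 2 with z
      by_cases h : x = z
      · subst h; simp
      · simp [h, Ne.symm h]
    have h_shift : HasSum (fun z => Q x z * kpow P n z y)
        (∑ k ∈ Finset.range (n + 1), (n.choose k : ℝ) / 2 ^ n * kpow Q (k + 1) x y) := by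
      have h := hasSum_sum (s := Finset.range (n + 1)) fun k _ =>
        (summable_mul_kpow hQ k x y).hasSum.mul_left ((n.choose k : ℝ) / 2 ^ n)
      refine h.congr_fun fun z => ?_
      rw [ih z, Finset.mul_sum]
      exact Finset.sum_congr rfl fun k _ => by ring
    have h_step : kpow P (n + 1) x y = (kpow P n x y +
        ∑ k ∈ Finset.range (n + 1), (n.choose k : ℝ) / 2 ^ n * kpow Q (k + 1) x y) / 2 := by
      rw [← ((h_diag.add h_shift).div_const 2).tsum_eq]
      exact tsum_congr fun z => by rw [hPQ]; ring
    rw [h_step, ih x, Finset.sum_range_succ' _ (n + 1)]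
    have h_pascal : ∀ k, ((n + 1).choose (k + 1) : ℝ) / 2 ^ (n + 1) * kpow Q (k + 1) x y =
        ((n.choose k : ℝ) / 2 ^ n * kpow Q (k + 1) x y +
          (n.choose (k + 1) : ℝ) / 2 ^ n * kpow Q (k + 1) x y) / 2 := fun k => by
      rw [Nat.choose_succ_succ, pow_succ]; push_cast; ring
    have h_top := Finset.sum_range_succ'
      (fun k => (n.choose k : ℝ) / 2 ^ n * kpow Q k x y) (n + 1)
    rw [Finset.sum_range_succ, Nat.choose_succ_self] at h_top
    simp only [h_pascal, ← Finset.sum_div, Finset.sum_add_distrib]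
    simp only [Nat.choose_zero_right, Nat.cast_zero, zero_div, zero_mul, add_zero] at h_top ⊢
    rw [h_top, pow_succ]
    ring

/-- The variance of the symmetric binomial distribution. -/
theorem sum_choose_mul_sq (m : ℕ) :
    ∑ k ∈ Finset.range (m + 1), (m.choose k : ℝ) / 2 ^ m * ((m : ℝ) - 2 * k) ^ 2 = (m : ℝ) := by
  have h := congrArg (Polynomial.eval (1 / 2 : ℝ)) (bernsteinPolynomial.variance ℝ m)
  simp only [Polynomial.eval_finsetSum, bernsteinPolynomial, Polynomial.eval_mul,
    Polynomial.eval_pow, Polynomial.eval_sub, Polynomial.eval_natCast, Polynomial.eval_X,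
    Polynomial.eval_one, nsmul_eq_mul] at h
  have h_term : ∀ k ∈ Finset.range (m + 1),
      (m.choose k : ℝ) / 2 ^ m * ((m : ℝ) - 2 * k) ^ 2 =
        4 * (((m : ℝ) * (1 / 2) - k) ^ 2 *
          ((m.choose k : ℝ) * (1 / 2) ^ k * (1 - 1 / 2) ^ (m - k))) := fun k hk => by
    have h_pow : (1 / 2 : ℝ) ^ k * (1 - 1 / 2) ^ (m - k) = 1 / 2 ^ m := by
      rw [show (1 - 1 / 2 : ℝ) = 1 / 2 by norm_num, ← pow_add,
        Nat.add_sub_cancel' (Finset.mem_range_succ_iff.1 hk), one_div_pow]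
    rw [mul_assoc (m.choose k : ℝ), h_pow]
    ring
  rw [Finset.sum_congr rfl h_term, ← Finset.mul_sum, h]
  ring

/-- The mean absolute deviation of the symmetric binomial distribution. -/
theorem sum_choose_mul_abs_le (m : ℕ) :
    ∑ k ∈ Finset.range (m + 1), (m.choose k : ℝ) / 2 ^ m * |(m : ℝ) - 2 * k| ≤ √m := by
  have h_one : ∑ k ∈ Finset.range (m + 1), (m.choose k : ℝ) / 2 ^ m = 1 := by
    rw [← Finset.sum_div, div_eq_one_iff_eq (by positivity)]
    exact_mod_cast Nat.sum_range_choose m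
  refine Real.le_sqrt_of_sq_le ?_
  calc (∑ k ∈ Finset.range (m + 1), (m.choose k : ℝ) / 2 ^ m * |(m : ℝ) - 2 * k|) ^ 2
      ≤ ∑ k ∈ Finset.range (m + 1), (m.choose k : ℝ) / 2 ^ m * |(m : ℝ) - 2 * k| ^ 2 :=
        Real.pow_arith_mean_le_arith_mean_pow _ _ _ (fun _ _ => by positivity) h_one
          (fun _ _ => abs_nonneg _) 2
    _ = m := by simpa only [sq_abs] using sum_choose_mul_sq m

theorem two_mul_choose_sub_choose_succ {n k : ℕ} (hk : k ≤ n + 1) :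
    ((n + 1 : ℕ) : ℝ) * (2 * n.choose k - (n + 1).choose k) =
      (n + 1).choose k * (((n + 1 : ℕ) : ℝ) - 2 * k) := by
  have h : (n.choose k : ℝ) * ((n + 1 : ℕ) : ℝ) = (n + 1).choose k * (((n + 1 : ℕ) : ℝ) - k) := by
    rw [← Nat.cast_sub hk]
    exact_mod_cast Nat.choose_mul_succ_eq n k
  linear_combination 2 * h

theorem dist1_kpow_lazy_le {Y : Type*} {P Q : Y → Y → ℝ}
    (hQ : ∀ x : Y, (∀ y, 0 ≤ Q x y) ∧ HasSum (Q x) 1)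
    (hPQ : ∀ x y, P x y = ((if x = y then 1 else 0) + Q x y) / 2) (n : ℕ) (x : Y) :
    dist1 (kpow P n x) (kpow P (n + 1) x) ≤ 1 / √((n + 1 : ℕ) : ℝ) := by
  set m : ℝ := ((n + 1 : ℕ) : ℝ) with hm
  have hm0 : 0 < m := by positivity
  have h_diff : ∀ y, kpow P n x y - kpow P (n + 1) x y = ∑ k ∈ Finset.range (n + 1 + 1),
      ((n + 1).choose k : ℝ) / 2 ^ (n + 1) * ((m - 2 * k) / m) * kpow Q k x y := fun y => by
    have h_ext : kpow P n x y =
        ∑ k ∈ Finset.range (n + 1 + 1), (n.choose k : ℝ) / 2 ^ n * kpow Q k x y := by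
      rw [Finset.sum_range_succ, Nat.choose_succ_self, kpow_lazy_eq_sum hQ hPQ]
      simp
    rw [h_ext, kpow_lazy_eq_sum hQ hPQ (n + 1), ← Finset.sum_sub_distrib]
    refine Finset.sum_congr rfl fun k hk => ?_
    have h := two_mul_choose_sub_choose_succ (Finset.mem_range_succ_iff.1 hk)
    rw [← hm] at h
    rw [div_mul_div_comm, ← h, pow_succ]
    field_simp
  have h_bound : HasSum (fun y => ∑ k ∈ Finset.range (n + 1 + 1),
      ((n + 1).choose k : ℝ) / 2 ^ (n + 1) * (|m - 2 * k| / m) * kpow Q k x y)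
      (∑ k ∈ Finset.range (n + 1 + 1),
        ((n + 1).choose k : ℝ) / 2 ^ (n + 1) * (|m - 2 * k| / m)) := by
    simpa only [mul_one] using hasSum_sum (s := Finset.range (n + 1 + 1)) fun k _ =>
      (kpow_stochastic hQ k x).2.mul_left
        (((n + 1).choose k : ℝ) / 2 ^ (n + 1) * (|m - 2 * k| / m))
  have h_le : ∀ y, |kpow P n x y - kpow P (n + 1) x y| ≤ ∑ k ∈ Finset.range (n + 1 + 1),
      ((n + 1).choose k : ℝ) / 2 ^ (n + 1) * (|m - 2 * k| / m) * kpow Q k x y := fun y => by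
    rw [h_diff]
    refine (Finset.abs_sum_le_sum_abs _ _).trans_eq (Finset.sum_congr rfl fun k _ => ?_)
    rw [abs_mul, abs_mul, abs_div (m - 2 * k), abs_of_pos hm0,
      abs_of_nonneg ((kpow_stochastic hQ k x).1 y), abs_of_nonneg (by positivity)]
  calc dist1 (kpow P n x) (kpow P (n + 1) x)
      ≤ ∑ k ∈ Finset.range (n + 1 + 1),
          ((n + 1).choose k : ℝ) / 2 ^ (n + 1) * (|m - 2 * k| / m) :=
        ((h_bound.summable.of_nonneg_of_le (fun _ => abs_nonneg _) h_le).tsum_le_tsum h_le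
          h_bound.summable).trans_eq h_bound.tsum_eq
    _ = (∑ k ∈ Finset.range (n + 1 + 1),
          ((n + 1).choose k : ℝ) / 2 ^ (n + 1) * |m - 2 * k|) / m := by
        rw [Finset.sum_div]
        exact Finset.sum_congr rfl fun k _ => by ring
    _ ≤ √m / m := by gcongr; exact sum_choose_mul_abs_le (n + 1)
    _ = 1 / √m := Real.sqrt_div_self'

/-- for a lazy irreducible kernel, consecutive-time distributions merge. -/
theorem stmt14 {X : Type*} [Countable X] (P : X → X → ℝ)
    (hP : ∀ x : X, (∀ y, 0 ≤ P x y) ∧ HasSum (P x) 1)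
    (hirr : ∀ x y : X, ∃ n : ℕ, 0 < kpow P n x y)
    (hlazy : ∀ x : X, (1 : ℝ) / 2 ≤ P x x) (x : X) :
    Filter.Tendsto (fun n => dist1 (kpow P n x) (kpow P (n + 1) x))
      Filter.atTop (nhds 0) := by
  have hQ : ∀ x : X, (∀ y, 0 ≤ 2 * P x y - (if x = y then 1 else 0)) ∧
      HasSum (fun y => 2 * P x y - (if x = y then 1 else 0)) 1 := fun x => by
    constructor
    · intro y
      split_ifs with h
      · subst h
        linarith [hlazy x]
      · linarith [(hP x).1 y]
    · have h_diag : HasSum (fun y => if x = y then (1 : ℝ) else 0) 1 := by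
        simpa only [eq_comm] using hasSum_ite_eq x (1 : ℝ)
      have h := ((hP x).2.mul_left 2).sub h_diag
      rwa [show (2 * 1 - 1 : ℝ) = 1 by norm_num] at h
  have h_lim : Tendsto (fun n : ℕ => 1 / √((n + 1 : ℕ) : ℝ)) atTop (nhds 0) := by
    simp only [one_div]
    exact (Real.tendsto_sqrt_atTop.comp
      (tendsto_natCast_atTop_atTop.comp (tendsto_add_atTop_nat 1))).inv_tendsto_atTop
  exact squeeze_zero (fun n => tsum_nonneg fun _ => abs_nonneg _)
    (fun n => dist1_kpow_lazy_le hQ (fun x y => by ring) n x) h_lim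
end
end
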